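/- Fix positive integers M1, M2, M3, a positive integer L, and a real r > 0. For i = 1, 2 and l = 1, ..., L+1, let H_{i,l} be mutually independent standard complex Gaussian random matrices of size M_{i+1}×M_i, and for ρ > 1 let C_{i,l}(ρ) = log det(I + (ρ/M_i) H_{i,l} H_{i,l}†). Define the fractional decoding times t_i(ρ) = inf{ t ∈ ℝ, t ≥ 0 : Σ_{l=1}^{⌊t⌋} C_{i,l}(ρ) + (t − ⌊t⌋)·C_{i,⌊t⌋+1}(ρ) ≥ r·log ρ }. Then lim_{ρ→∞} log P( t_1(ρ) + t_2(ρ) > L ) / log ρ = − inf{ h̃(α) : α ∈ G }, where with M_i* = min(M_i, M_{i+1}): h̃(α) = Σ_{i=1}^{2} Σ_{j=1}^{M_i*} Σ_{l=1}^{L} (2j − 1 + |M_i − M_{i+1}|)·α_{i,j}^l; S_i(α_i^l) = Σ_{j=1}^{M_i*} max(1 − α_{i,j}^l, 0); T_i(α) = inf{ t ≥ 0 : Σ_{l=1}^{⌊t⌋} S_i(α_i^l) + (t − ⌊t⌋)·S_i(α_i^{⌊t⌋+1}) ≥ r }; and G = { α = (α_1, α_2), α_i ∈ ℝ^{M_i*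 × L} : α_{i,1}^l ≥ α_{i,2}^l ≥ ... ≥ α_{i,M_i*}^l ≥ 0 for all i, l, and T_1(α) + T_2(α) > L }. (Theorem 6: DMDT of the VBL ARQ protocol for a three-node MIMO multihop network under the short-term static channel assumption.) -/

import Mathlib

open MeasureTheory ProbabilityTheory

/-- The capacity `log det (I + (ρ / M) H Hᴴ)` of a MIMO channel with matrix `H`. -/
noncomputable def cap {a b : ℕ} (M : ℕ) (ρ : ℝ) (H : Matrix (Fin a) (Fin b) ℂ) : ℝ :=
  Real.log ((1 + ((ρ / M : ℝ) : ℂ) • (H * H.conjTranspose)).det.re)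

/-- The accumulated quantity `Σ_{l=1}^{⌊t⌋} f_l + (t - ⌊t⌋) f_{⌊t⌋+1}` at fractional
time `t ≥ 0`, where the increments `f : ℕ → ℝ` are zero-indexed (`f l` is the increment
of round `l + 1`). -/
noncomputable def accum (f : ℕ → ℝ) (t : ℝ) : ℝ :=
  (∑ l ∈ Finset.range ⌊t⌋₊, f l) + (t - ⌊t⌋₊) * f ⌊t⌋₊

/-- The fractional decoding time `inf {t ∈ ℝ, t ≥ 0 : accum f t ≥ R}`, as an extended
real (the infimum over the empty set being `+∞`). -/
noncomputable def fracDecTime (f : ℕ → ℝ) (R : ℝ) : EReal :=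
  sInf {x : EReal | ∃ t : ℝ, x = (t : EReal) ∧ 0 ≤ t ∧ R ≤ accum f t}

/-- `S_i(α_i^l) = Σ_j (1 - α_{i,j}^l)⁺` for `l < L` (zero-indexed), extended by `0` for
`l ≥ L` (so that the accumulated quantity stays constant after time `L`, implementing
the convention that an infimum over an empty set is `+∞`). -/
noncomputable def Sext {m L : ℕ} (α : Fin m → Fin L → ℝ) (l : ℕ) : ℝ :=
  if h : l < L then ∑ j, max (1 - α j ⟨l, h⟩) 0 else 0

open MeasureTheory ProbabilityTheory

open scoped ComplexOrder in
lemma one_le_det_one_add {n : ℕ} {A : Matrix (Fin n) (Fin n) ℂ} (hA : A.PosSemidef) :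
    1 ≤ (1 + A).det.re ∧ (1 + A).det.im = 0 := by
  have hH := hA.1
  have h1 : (1 + A).det = ((∏ i, (1 + hH.eigenvalues i) : ℝ) : ℂ) := by
    have h := congrArg (Polynomial.eval (-1)) hH.charpoly_eq
    rw [Matrix.eval_charpoly, Polynomial.eval_prod] at h
    have e : Matrix.scalar (Fin n) (-1 : ℂ) - A = -(1 + A) := by
      simp [Matrix.scalar_apply]
      ext i j
      by_cases hij : i = j
      · subst hij; simp; ring
      · simp [hij]
    rw [e, Matrix.det_neg] at h
    have e2 : ∀ i, Polynomial.eval (-1 : ℂ) (Polynomial.X - Polynomial.C ((hH.eigenvalues i : ℝ) : ℂ))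
        = (-1) * (1 + (hH.eigenvalues i : ℂ)) := by intro i; simp; ring
    have e3 : (∏ i, Polynomial.eval (-1 : ℂ) (Polynomial.X - Polynomial.C ((hH.eigenvalues i : ℝ) : ℂ)))
        = (-1) ^ n * ∏ i, (1 + (hH.eigenvalues i : ℂ)) := by
      rw [Finset.prod_congr rfl (fun i _ => e2 i), Finset.prod_mul_distrib]; simp
    have h' := h.trans e3
    simp only [Fintype.card_fin] at h'
    have := mul_left_cancel₀ (pow_ne_zero n (by norm_num : (-1 : ℂ) ≠ 0)) h'
    rw [this]; push_cast; rfl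
  rw [h1]
  refine ⟨?_, Complex.ofReal_im _⟩
  rw [Complex.ofReal_re]
  have : ∏ i : Fin n, (1:ℝ) ≤ ∏ i, (1 + hH.eigenvalues i) := by
    apply Finset.prod_le_prod
    · intros; norm_num
    · intro i _; have := hA.eigenvalues_nonneg i; linarith
  simpa using this

open scoped ComplexOrder MatrixOrder in
lemma det_mono_psd {n : ℕ} {A N : Matrix (Fin n) (Fin n) ℂ} (hA : A.PosDef) (hN : N.PosSemidef) :
    A.det.re ≤ (A + N).det.re := by
  obtain ⟨B, rfl⟩ := CStarAlgebra.nonneg_iff_eq_star_mul_self.mp hN.nonneg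
  have hu : IsUnit A.det := (Matrix.isUnit_iff_isUnit_det A).mp hA.isUnit
  have h1 : A + star B * B = A * (1 + (A⁻¹ * star B) * B) := by
    rw [mul_add, mul_one, ← mul_assoc, ← mul_assoc, Matrix.mul_nonsing_inv _ hu, one_mul]
  have h2 : (A + star B * B).det = A.det * (1 + B * A⁻¹ * star B).det := by
    rw [h1, Matrix.det_mul, Matrix.det_one_add_mul_comm, mul_assoc]
  have h3 : (B * A⁻¹ * star B).PosSemidef := hA.inv.posSemidef.mul_mul_conjTranspose_same B
  have h4 := one_le_det_one_add h3
  have h5 := hA.det_pos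
  rw [Complex.lt_def] at h5
  rw [h2, Complex.mul_re, h4.2]
  simp only [Complex.zero_re] at h5
  nlinarith [h4.1, h5.1]

/-- `det (I + ρ H Hᴴ)`. -/
noncomputable def ff {p q : ℕ} (ρ : ℝ) (H : Matrix (Fin p) (Fin q) ℂ) : ℝ :=
  (1 + (ρ : ℂ) • (H * H.conjTranspose)).det.re

open scoped ComplexOrder in
lemma psd_smul {p q : ℕ} {ρ : ℝ} (hρ : 0 ≤ ρ) (H : Matrix (Fin p) (Fin q) ℂ) :
    ((ρ : ℂ) • (H * H.conjTranspose)).PosSemidef := by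
  apply (Matrix.posSemidef_self_mul_conjTranspose H).smul
  exact_mod_cast hρ

open scoped ComplexOrder in
lemma psd_smul' {p q : ℕ} {ρ : ℝ} (hρ : 0 ≤ ρ) {K : Matrix (Fin p) (Fin q) ℂ} :
    ((ρ : ℂ) • (K.conjTranspose * K)).PosSemidef := by
  apply (Matrix.posSemidef_conjTranspose_mul_self K).smul
  exact_mod_cast hρ

lemma one_le_ff {p q : ℕ} {ρ : ℝ} (hρ : 0 ≤ ρ) (H : Matrix (Fin p) (Fin q) ℂ) : 1 ≤ ff ρ H :=
  (one_le_det_one_add (psd_smul hρ H)).1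

lemma ff_comm {p q : ℕ} (ρ : ℝ) (H : Matrix (Fin p) (Fin q) ℂ) :
    ff ρ H = (1 + (ρ : ℂ) • (H.conjTranspose * H)).det.re := by
  unfold ff
  rw [← Matrix.smul_mul, Matrix.det_one_add_mul_comm, Matrix.mul_smul]

open scoped ComplexOrder in
lemma psd_bdd {m n : ℕ} {A : Matrix (Fin m) (Fin n) ℂ} {K : ℝ} (hK : ∀ i j, ‖A i j‖ ≤ K) :
    (((m * n * K ^ 2 : ℝ) : ℂ) • (1 : Matrix (Fin n) (Fin n) ℂ) - A.conjTranspose * A).PosSemidef := by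
  apply Matrix.PosSemidef.of_dotProduct_mulVec_nonneg
  · apply Matrix.IsHermitian.sub
    · rw [Matrix.IsHermitian, Matrix.conjTranspose_smul]; simp
    · exact Matrix.isHermitian_conjTranspose_mul_self A
  · intro x
    have e1 : dotProduct (star x) ((A.conjTranspose * A).mulVec x) = ((∑ i, ‖A.mulVec x i‖ ^ 2 : ℝ) : ℂ) := by
      rw [← Matrix.mulVec_mulVec, Matrix.dotProduct_mulVec, Matrix.vecMul_conjTranspose, star_star]
      simp only [dotProduct, Pi.star_apply]
      push_cast
      refine Finset.sum_congr rfl fun i _ => ?_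
      rw [← Complex.conj_mul']; rfl
    have e2 : dotProduct (star x) x = ((∑ i, ‖x i‖ ^ 2 : ℝ) : ℂ) := by
      simp only [dotProduct, Pi.star_apply]
      push_cast
      refine Finset.sum_congr rfl fun i _ => ?_
      rw [← Complex.conj_mul']; rfl
    rw [Matrix.sub_mulVec, dotProduct_sub, e1, Matrix.smul_mulVec, Matrix.one_mulVec, dotProduct_smul, e2]
    rw [smul_eq_mul, ← Complex.ofReal_mul, ← Complex.ofReal_sub]
    rw [Complex.zero_le_real, sub_nonneg]
    calc ∑ i, ‖A.mulVec x i‖ ^ 2 ≤ ∑ i : Fin m, (n * K ^ 2) * ∑ j, ‖x j‖ ^ 2 := by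
          apply Finset.sum_le_sum; intro i _
          have h1 : ‖A.mulVec x i‖ ≤ ∑ j, ‖A i j‖ * ‖x j‖ := by
            simp only [Matrix.mulVec, dotProduct]
            refine (norm_sum_le _ _).trans (le_of_eq ?_)
            simp
          calc ‖A.mulVec x i‖ ^ 2 ≤ (∑ j, ‖A i j‖ * ‖x j‖) ^ 2 := by gcongr
            _ ≤ (∑ j, ‖A i j‖ ^ 2) * ∑ j, ‖x j‖ ^ 2 := Finset.sum_mul_sq_le_sq_mul_sq _ _ _
            _ ≤ _ := by
              gcongr
              calc ∑ j, ‖A i j‖ ^ 2 ≤ ∑ j : Fin n, K ^ 2 := by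
                    apply Finset.sum_le_sum; intro j _; gcongr; exact hK i j
                _ = _ := by simp
      _ = _ := by simp; ring

open scoped ComplexOrder in
lemma ff_mul_left {m p q : ℕ} {A : Matrix (Fin m) (Fin p) ℂ} {ρ K : ℝ} (hρ : 0 ≤ ρ)
    (hK : ∀ i j, ‖A i j‖ ≤ K) (H : Matrix (Fin p) (Fin q) ℂ) :
    ff ρ (A * H) ≤ (1 + m * p * K ^ 2) ^ q * ff ρ H := by
  set c : ℝ := m * p * K ^ 2 with hc
  have hc0 : 0 ≤ c := by positivity
  rw [ff_comm, ff_comm]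
  have h0 := psd_bdd hK
  rw [← hc] at h0
  have h1 := (h0.conjTranspose_mul_mul_same H).smul (a := (ρ : ℂ)) (by exact_mod_cast hρ)
  have h2 : ((ρ : ℂ) • (H.conjTranspose * H)).PosSemidef := psd_smul' hρ
  have h3 : ((c : ℂ) • (1 : Matrix (Fin q) (Fin q) ℂ)).PosSemidef :=
    Matrix.PosSemidef.one.smul (by exact_mod_cast hc0)
  have hP : (1 + (ρ : ℂ) • ((A * H).conjTranspose * (A * H))).PosDef :=
    Matrix.PosDef.one.add_posSemidef (psd_smul' hρ)
  have h4 := det_mono_psd hP ((h1.add h2).add h3)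
  refine h4.trans (le_of_eq ?_)
  have e : (1 + (ρ : ℂ) • ((A * H).conjTranspose * (A * H)) +
      ((ρ : ℂ) • (H.conjTranspose * ((c : ℂ) • (1 : Matrix (Fin p) (Fin p) ℂ) - A.conjTranspose * A) * H)
       + (ρ : ℂ) • (H.conjTranspose * H) + (c : ℂ) • (1 : Matrix (Fin q) (Fin q) ℂ)))
      = ((1 + c : ℝ) : ℂ) • (1 + (ρ : ℂ) • (H.conjTranspose * H)) := by
    rw [Matrix.conjTranspose_mul, Matrix.mul_sub, Matrix.sub_mul]
    simp only [Matrix.mul_smul, Matrix.mul_one, Matrix.smul_mul, Matrix.mul_assoc]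
    push_cast
    module
  rw [e, Matrix.det_smul, Fintype.card_fin, ← Complex.ofReal_pow, Complex.re_ofReal_mul]

lemma ff_conjTranspose {p q : ℕ} (ρ : ℝ) (H : Matrix (Fin p) (Fin q) ℂ) :
    ff ρ H.conjTranspose = ff ρ H := by
  rw [ff_comm ρ H, ff, Matrix.conjTranspose_conjTranspose]

lemma ff_mul_right {m p q : ℕ} {A : Matrix (Fin q) (Fin m) ℂ} {ρ K : ℝ} (hρ : 0 ≤ ρ)
    (hK : ∀ i j, ‖A i j‖ ≤ K) (H : Matrix (Fin p) (Fin q) ℂ) :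
    ff ρ (H * A) ≤ (1 + m * q * K ^ 2) ^ p * ff ρ H := by
  rw [← ff_conjTranspose ρ (H * A), Matrix.conjTranspose_mul, ← ff_conjTranspose ρ H]
  apply ff_mul_left hρ
  intro i j; simpa using hK j i

lemma ff_submatrix {p q : ℕ} (ρ : ℝ) (H : Matrix (Fin p) (Fin q) ℂ)
    (e : Equiv.Perm (Fin p)) (e' : Equiv.Perm (Fin q)) :
    ff ρ (H.submatrix e e') = ff ρ H := by
  unfold ff
  have : (1 + (ρ : ℂ) • (H.submatrix e e' * (H.submatrix e e').conjTranspose))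
      = (1 + (ρ : ℂ) • (H * H.conjTranspose)).submatrix e e := by
    rw [Matrix.conjTranspose_submatrix, Matrix.submatrix_mul_equiv]
    simp [Matrix.submatrix_add, Matrix.submatrix_smul]
  rw [this, Matrix.det_submatrix_equiv_self]

/-- assemble a block matrix. -/
def asm {p q : ℕ} (a : ℂ) (b : Fin q → ℂ) (c : Fin p → ℂ) (D : Fin p → Fin q → ℂ) :
    Fin (p+1) → Fin (q+1) → ℂ :=
  Fin.cons (Fin.cons a b) (fun i => Fin.cons (c i) (D i))

lemma ff_diag {p q : ℕ} (ρ : ℝ) (a : ℂ) (D : Fin p → Fin q → ℂ) :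
    ff ρ (Matrix.of (asm a 0 0 D)) = (1 + ρ * ‖a‖ ^ 2) * ff ρ (Matrix.of D) := by
  unfold ff
  obtain ⟨X, hX⟩ : ∃ X : Matrix (Fin (p+1)) (Fin (p+1)) ℂ,
    X = 1 + (ρ : ℂ) • (Matrix.of (asm a 0 0 D) * (Matrix.of (asm a 0 0 D)).conjTranspose) := ⟨_, rfl⟩
  obtain ⟨Y, hY⟩ : ∃ Y : Matrix (Fin p) (Fin p) ℂ,
    Y = 1 + (ρ : ℂ) • (Matrix.of D * (Matrix.of D).conjTranspose) := ⟨_, rfl⟩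
  have e : ∀ i j : Fin p, X i.succ j.succ = Y i j := by
    intro i j
    rw [hX, hY]
    simp [Matrix.mul_apply, Fin.sum_univ_succ, asm, Matrix.one_apply]
  have e0 : ∀ j : Fin p, X 0 j.succ = 0 := by
    intro j
    rw [hX]
    simp [Matrix.mul_apply, Fin.sum_univ_succ, asm, Matrix.one_apply, (Fin.succ_ne_zero j).symm]
  have e00 : X 0 0 = ((1 + ρ * ‖a‖ ^ 2 : ℝ) : ℂ) := by
    rw [hX]
    simp [Matrix.mul_apply, Fin.sum_univ_succ, asm, Complex.mul_conj']
  rw [← hX, ← hY, Matrix.det_succ_row_zero, Fin.sum_univ_succ, e00]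
  simp only [e0]
  have e3 : X.submatrix Fin.succ (Fin.succAbove 0) = Y := by
    ext i j
    simp only [Matrix.submatrix_apply, Fin.zero_succAbove]
    exact e i j
  rw [e3]
  simp only [Fin.val_zero, pow_zero, one_mul, mul_zero, zero_mul, Finset.sum_const_zero, add_zero]
  rw [Complex.re_ofReal_mul]

lemma asm_factor {p q : ℕ} {a : ℂ} (ha : a ≠ 0) (b : Fin q → ℂ) (c : Fin p → ℂ)
    (D : Fin p → Fin q → ℂ) :
    (Matrix.of (asm a b c (fun i j => D i j + c i * b j / a)) : Matrix (Fin (p+1)) (Fin (q+1)) ℂ) =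
      Matrix.of (asm 1 0 (fun i => c i / a) (1 : Matrix (Fin p) (Fin p) ℂ))
        * Matrix.of (asm a 0 0 D)
        * Matrix.of (asm 1 (fun j => b j / a) 0 (1 : Matrix (Fin q) (Fin q) ℂ)) := by
  ext i j
  refine Fin.cases ?_ (fun i => ?_) i <;> refine Fin.cases ?_ (fun j => ?_) j
  · simp [Matrix.mul_apply, Fin.sum_univ_succ, asm]
  · simp [Matrix.mul_apply, Fin.sum_univ_succ, asm]; field_simp
  · simp [Matrix.mul_apply, Fin.sum_univ_succ, asm]; field_simp
  · simp [Matrix.mul_apply, Fin.sum_univ_succ, asm, Matrix.one_apply]; field_simp; ring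

lemma asm_factor' {p q : ℕ} {a : ℂ} (ha : a ≠ 0) (b : Fin q → ℂ) (c : Fin p → ℂ)
    (D : Fin p → Fin q → ℂ) :
    Matrix.of (asm a 0 0 D) =
      Matrix.of (asm 1 0 (fun i => - c i / a) (1 : Matrix (Fin p) (Fin p) ℂ))
        * (Matrix.of (asm a b c (fun i j => D i j + c i * b j / a)) : Matrix (Fin (p+1)) (Fin (q+1)) ℂ)
        * Matrix.of (asm 1 (fun j => - b j / a) 0 (1 : Matrix (Fin q) (Fin q) ℂ)) := by
  ext i j
  refine Fin.cases ?_ (fun i => ?_) i <;> refine Fin.cases ?_ (fun j => ?_) j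
  · simp [Matrix.mul_apply, Fin.sum_univ_succ, asm]
  · simp [Matrix.mul_apply, Fin.sum_univ_succ, asm, Matrix.one_apply]; field_simp; ring
  · simp [Matrix.mul_apply, Fin.sum_univ_succ, asm, Matrix.one_apply]; field_simp; ring
  · simp [Matrix.mul_apply, Fin.sum_univ_succ, asm, Matrix.one_apply]; field_simp; ring

lemma entry_bdd_L {p : ℕ} {c : Fin p → ℂ} {q : ℕ} {b : Fin q → ℂ}
    (hc : ∀ i, ‖c i‖ ≤ 2) (hb : ∀ i, ‖b i‖ ≤ 2) (D : Matrix (Fin p) (Fin q) ℂ)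
    (hD : ∀ i j, ‖D i j‖ ≤ 2) :
    ∀ i j, ‖(Matrix.of (asm 1 b c D) : Matrix (Fin (p+1)) (Fin (q+1)) ℂ) i j‖ ≤ 2 := by
  intro i j
  refine Fin.cases ?_ (fun i => ?_) i <;> refine Fin.cases ?_ (fun j => ?_) j
  · simp [asm]
  · simpa [asm] using hb j
  · simpa [asm] using hc i
  · simpa [asm] using hD i j

lemma one_bdd {p : ℕ} (i j : Fin p) : ‖(1 : Matrix (Fin p) (Fin p) ℂ) i j‖ ≤ 2 := by
  rw [Matrix.one_apply]; split_ifs <;> simp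

lemma ff_asm (p q : ℕ) : ∃ κ : ℝ, 0 < κ ∧ ∀ (ρ : ℝ), 0 ≤ ρ → ∀ (a : ℂ) (b : Fin q → ℂ) (c : Fin p → ℂ)
    (D : Fin p → Fin q → ℂ), a ≠ 0 → (∀ j, ‖b j‖ ≤ 2 * ‖a‖) → (∀ i, ‖c i‖ ≤ 2 * ‖a‖) →
    ff ρ (Matrix.of (asm a b c (fun i j => D i j + c i * b j / a)))
      ≤ κ * ((1 + ρ * ‖a‖ ^ 2) * ff ρ (Matrix.of D)) ∧
    (1 + ρ * ‖a‖ ^ 2) * ff ρ (Matrix.of D) ≤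
      κ * ff ρ (Matrix.of (asm a b c (fun i j => D i j + c i * b j / a))) := by
  refine ⟨(1 + ((q+1:ℕ):ℝ) * ((q+1 : ℕ):ℝ) * 2 ^ 2) ^ (p+1) * (1 + ((p+1:ℕ):ℝ) * ((p+1:ℕ):ℝ) * 2 ^ 2) ^ (q+1), by positivity, ?_⟩
  intro ρ hρ a b c D ha hb hc
  have ha' : 0 < ‖a‖ := norm_pos_iff.mpr ha
  have hb' : ∀ j, ‖b j / a‖ ≤ 2 := fun j => by rw [norm_div, div_le_iff₀ ha']; exact hb j
  have hc' : ∀ j, ‖c j / a‖ ≤ 2 := fun j => by rw [norm_div, div_le_iff₀ ha']; exact hc j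
  constructor
  · rw [asm_factor ha, ← ff_diag, mul_assoc (_ ^ _)]
    refine (ff_mul_right (K := 2) hρ (entry_bdd_L (by simp) hb' _ one_bdd) _).trans ?_
    gcongr
    exact ff_mul_left (K := 2) hρ (entry_bdd_L hc' (by simp) _ one_bdd) _
  · rw [← ff_diag, asm_factor' ha b c D, mul_assoc (_ ^ _)]
    refine (ff_mul_right (K := 2) hρ (entry_bdd_L (by simp) (by simpa [neg_div] using hb') _ one_bdd) _).trans ?_
    gcongr
    exact ff_mul_left (K := 2) hρ (entry_bdd_L (by simpa [neg_div] using hc') (by simp) _ one_bdd) _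

open MeasureTheory ProbabilityTheory

lemma lintegral_cons {n : ℕ} {E : Type} [MeasureSpace E] [SigmaFinite (volume : Measure E)]
    {F : (Fin (n+1) → E) → ENNReal} (hF : Measurable F) :
    ∫⁻ h, F h = ∫⁻ a : E, ∫⁻ t : Fin n → E, F (Fin.cons a t) := by
  have hmp := (volume_preserving_piFinSuccAbove (fun _ : Fin (n+1) => E) 0).symm
  rw [← hmp.lintegral_comp_emb (MeasurableEquiv.measurableEmbedding _)]
  rw [Measure.volume_eq_prod, lintegral_prod]
  · refine lintegral_congr fun a => lintegral_congr fun t => ?_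
    congr 1
    exact Fin.insertNth_zero' a t
  · exact (hF.comp (MeasurableEquiv.measurable _)).aemeasurable

lemma lintegral_rows {p q : ℕ}
    {F : (Fin p → Fin (q+1) → ℂ) → ENNReal} (hF : Measurable F) :
    ∫⁻ h, F h = ∫⁻ c : Fin p → ℂ, ∫⁻ D : Fin p → Fin q → ℂ, F (fun i => Fin.cons (c i) (D i)) := by
  have h1 := volume_preserving_pi (fun _ : Fin p => (volume_preserving_piFinSuccAbove (fun _ : Fin (q+1) => ℂ) 0).symm)
  have h2 := (volume_measurePreserving_arrowProdEquivProdArrow ℂ (Fin q → ℂ) (Fin p)).symm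
  have h3 := h1.comp h2
  rw [← h3.lintegral_comp hF, Measure.volume_eq_prod, lintegral_prod]
  · refine lintegral_congr fun a => lintegral_congr fun t => ?_
    congr 1
    ext i
    exact congrFun (Fin.insertNth_zero' (a i) (t i)) _
  · exact (hF.comp h3.measurable).aemeasurable

lemma measurable_cons {n : ℕ} {E : Type} [MeasurableSpace E] :
    Measurable (fun x : E × (Fin n → E) => (Fin.cons x.1 x.2 : Fin (n+1) → E)) := by
  rw [measurable_pi_iff]
  intro i
  refine Fin.cases ?_ (fun i => ?_) i
  · simpa using measurable_fst
  · simp only [Fin.cons_succ]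
    exact (measurable_pi_apply i).comp measurable_snd

lemma measurable_consrows {p q : ℕ} :
    Measurable (fun x : (Fin p → ℂ) × (Fin p → Fin q → ℂ) =>
      (fun i => Fin.cons (x.1 i) (x.2 i) : Fin p → Fin (q+1) → ℂ)) := by
  rw [measurable_pi_iff]
  intro i
  exact measurable_cons.comp (f := fun x : (Fin p → ℂ) × (Fin p → Fin q → ℂ) => (x.1 i, x.2 i)) (by fun_prop)

lemma lintegral_asm {p q : ℕ} {F : (Fin (p+1) → Fin (q+1) → ℂ) → ENNReal} (hF : Measurable F) :
    ∫⁻ h, F h = ∫⁻ a : ℂ, ∫⁻ b : Fin q → ℂ, ∫⁻ c : Fin p → ℂ, ∫⁻ D : Fin p → Fin q → ℂ,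
      F (asm a b c D) := by
  rw [lintegral_cons hF]
  have hG : Measurable (fun row : Fin (q+1) → ℂ => ∫⁻ t : Fin p → Fin (q+1) → ℂ, F (Fin.cons row t)) := by
    apply Measurable.lintegral_prod_right' (f := fun x : (Fin (q+1) → ℂ) × (Fin p → Fin (q+1) → ℂ) => F (Fin.cons x.1 x.2))
    exact hF.comp measurable_cons
  rw [lintegral_cons hG]
  refine lintegral_congr fun a => lintegral_congr fun b => ?_
  rw [lintegral_rows]
  · rfl
  · exact hF.comp (measurable_cons.comp measurable_prodMk_left)

lemma lintegral_asm' {p q : ℕ} {F : (Fin (p+1) → Fin (q+1) → ℂ) → ENNReal} (hF : Measurable F) :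
    ∫⁻ h, F h = ∫⁻ a : ℂ, ∫⁻ b : Fin q → ℂ, ∫⁻ c : Fin p → ℂ, ∫⁻ D : Fin p → Fin q → ℂ,
      F (asm a b c (fun i j => D i j + c i * b j / a)) := by
  rw [lintegral_asm hF]
  refine lintegral_congr fun a => lintegral_congr fun b => lintegral_congr fun c => ?_
  rw [← lintegral_add_right_eq_self _ (fun i j => c i * b j / a)]
  rfl

lemma continuous_ff {p q : ℕ} (ρ : ℝ) :
    Continuous (fun H : Fin p → Fin q → ℂ => ff ρ (Matrix.of H)) := by
  unfold ff
  apply Complex.continuous_re.comp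
  apply Continuous.matrix_det
  have : Continuous (fun H : Fin p → Fin q → ℂ => (Matrix.of H : Matrix (Fin p) (Fin q) ℂ)) := continuous_id
  have h2 := this.matrix_conjTranspose
  exact continuous_const.add ((this.matrix_mul h2).const_smul (ρ : ℂ))

lemma mp_swap {p q : ℕ} (e : Equiv.Perm (Fin p)) (e' : Equiv.Perm (Fin q)) :
    MeasurePreserving (fun H : Fin p → Fin q → ℂ => (fun i j => H (e i) (e' j))) volume volume := by
  have h1 := volume_measurePreserving_piCongrLeft (fun _ : Fin p => Fin q → ℂ) e.symm
  have h2 := volume_preserving_pi (fun _ : Fin p => volume_measurePreserving_piCongrLeft (fun _ : Fin q => ℂ) e'.symm)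
  have h3 := h2.comp h1
  have e1 : (fun H : Fin p → Fin q → ℂ => (fun i j => H (e i) (e' j))) =
    (fun a i => (MeasurableEquiv.piCongrLeft (fun x => ℂ) (Equiv.symm e')) (a i)) ∘
      ⇑(MeasurableEquiv.piCongrLeft (fun x => Fin q → ℂ) (Equiv.symm e)) := by
    ext H i j
    simp [MeasurableEquiv.coe_piCongrLeft, Equiv.piCongrLeft_apply]
  rw [e1]
  exact h3

lemma exists_norm_entry {p q : ℕ} (H : Fin (p+1) → Fin (q+1) → ℂ) : ∃ i j, ‖H i j‖ = ‖H‖ := by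
  obtain ⟨⟨i, j⟩, hij⟩ := Finite.exists_max (fun x : Fin (p+1) × Fin (q+1) => ‖H x.1 x.2‖)
  refine ⟨i, j, le_antisymm ((norm_le_pi_norm (H i) j).trans (norm_le_pi_norm H i)) ?_⟩
  rw [pi_norm_le_iff_of_nonneg (norm_nonneg _)]
  intro k
  rw [pi_norm_le_iff_of_nonneg (norm_nonneg _)]
  intro l
  exact hij (k, l)

lemma vol_closedBall (q : ℕ) {r : ℝ} (hr : 0 ≤ r) :
    volume (Metric.closedBall (0 : Fin q → ℂ) r) = ENNReal.ofReal ((Real.pi * r ^ 2) ^ q) := by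
  rw [volume_pi_closedBall _ hr]
  simp only [Complex.volume_closedBall, Finset.prod_const, Finset.card_univ, Fintype.card_fin]
  rw [ENNReal.ofReal_pow (by positivity), ENNReal.ofReal_mul Real.pi_pos.le, mul_comm, ENNReal.ofReal_pow hr]
  congr 2
  exact (ENNReal.ofReal_coe_nnreal (p := NNReal.pi)).symm

lemma sum_w (p q : ℕ) : ∑ j ∈ Finset.range (min p q), (2 * (j : ℝ) + 1 + |(p : ℝ) - q|) = p * q := by
  have h : ∀ n : ℕ, ∀ c : ℝ, ∑ j ∈ Finset.range n, (2 * (j : ℝ) + 1 + c) = n * (n + c) := by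
    intro n c
    induction n with
    | zero => simp
    | succ n ih => rw [Finset.sum_range_succ, ih]; push_cast; ring
  rw [h]
  rcases le_total p q with hpq | hpq
  · rw [min_eq_left hpq, abs_of_nonpos (sub_nonpos.mpr (by exact_mod_cast hpq))]; ring
  · rw [min_eq_right hpq, abs_of_nonneg (sub_nonneg.mpr (by exact_mod_cast hpq))]; ring

lemma w_last (p q : ℕ) : 2 * ((min p q : ℕ) : ℝ) + 1 + |(p : ℝ) - q| = p + q + 1 := by
  rcases le_total p q with hpq | hpq
  · rw [min_eq_left hpq, abs_of_nonpos (sub_nonpos.mpr (by exact_mod_cast hpq))]; ring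
  · rw [min_eq_right hpq, abs_of_nonneg (sub_nonneg.mpr (by exact_mod_cast hpq))]; ring

lemma vol_univ_zero (p q : ℕ) (h : p = 0 ∨ q = 0) : volume (Set.univ : Set (Fin p → Fin q → ℂ)) = 1 := by
  rw [volume_pi, Measure.pi_univ]
  rcases h with rfl | rfl
  · simp
  · apply Finset.prod_eq_one; intro i _; rw [volume_pi, Measure.pi_univ]; simp

open MeasureTheory ProbabilityTheory

/-- the integrand -/
noncomputable def gg {p q : ℕ} (s ρ b : ℝ) (H : Fin p → Fin q → ℂ) : ENNReal :=
  ENNReal.ofReal (Real.exp (-b * ‖H‖ ^ 2) * (ff ρ (Matrix.of H)) ^ (-s))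

lemma measurable_gg {p q : ℕ} (s ρ b : ℝ) : Measurable (gg (p := p) (q := q) s ρ b) := by
  unfold gg
  apply Measurable.ennreal_ofReal
  apply Measurable.mul
  · apply Continuous.measurable; fun_prop
  · exact (continuous_ff ρ).measurable.pow_const _

lemma gg_swap {p q : ℕ} (s ρ b : ℝ) (H : Fin p → Fin q → ℂ) (e : Equiv.Perm (Fin p)) (e' : Equiv.Perm (Fin q)) :
    gg s ρ b (fun i j => H (e i) (e' j)) = gg s ρ b H := by
  unfold gg
  have h1 : ff ρ (Matrix.of (fun i j => H (e i) (e' j))) = ff ρ (Matrix.of H) := ff_submatrix ρ (Matrix.of H) e e'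
  rw [h1]
  have h2 : ‖(fun i j => H (e i) (e' j))‖ = ‖H‖ := by
    apply le_antisymm
    · rw [pi_norm_le_iff_of_nonneg (norm_nonneg _)]; intro k
      rw [pi_norm_le_iff_of_nonneg (norm_nonneg _)]; intro l
      exact (norm_le_pi_norm (H (e k)) (e' l)).trans (norm_le_pi_norm H (e k))
    · rw [pi_norm_le_iff_of_nonneg (norm_nonneg _)]; intro k
      rw [pi_norm_le_iff_of_nonneg (norm_nonneg _)]; intro l
      have h1 := norm_le_pi_norm (fun i j => H (e i) (e' j)) (e.symm k)
      have h2 := norm_le_pi_norm (fun j => H (e (e.symm k)) (e' j)) (e'.symm l)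
      simp only [Equiv.apply_symm_apply] at h1 h2
      exact h2.trans h1
  rw [h2]

lemma gg_pivot {p q : ℕ} (s ρ b : ℝ) :
    ∫⁻ H : Fin (p+1) → Fin (q+1) → ℂ, gg s ρ b H ≤
      ((p+1 : ℕ) * (q+1 : ℕ) : ENNReal) * ∫⁻ H : Fin (p+1) → Fin (q+1) → ℂ,
        ({H | ‖H 0 0‖ = ‖H‖}).indicator (gg s ρ b) H := by
  have hm : MeasurableSet {H : Fin (p+1) → Fin (q+1) → ℂ | ‖H 0 0‖ = ‖H‖} :=
    (isClosed_eq (by fun_prop) (by fun_prop)).measurableSet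
  have hmeas := (measurable_gg (p := p+1) (q := q+1) s ρ b).indicator hm
  have key : ∀ i j, ∫⁻ H : Fin (p+1) → Fin (q+1) → ℂ, ({H | ‖H 0 0‖ = ‖H‖}).indicator (gg s ρ b)
        (fun k l => H (Equiv.swap 0 i k) (Equiv.swap 0 j l)) = ∫⁻ H : Fin (p+1) → Fin (q+1) → ℂ,
        ({H | ‖H 0 0‖ = ‖H‖}).indicator (gg s ρ b) H := by
    intro i j
    exact (mp_swap (Equiv.swap 0 i) (Equiv.swap 0 j)).lintegral_comp hmeas
  calc ∫⁻ H : Fin (p+1) → Fin (q+1) → ℂ, gg s ρ b H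
      ≤ ∫⁻ H : Fin (p+1) → Fin (q+1) → ℂ, ∑ x : Fin (p+1) × Fin (q+1),
          ({H | ‖H 0 0‖ = ‖H‖}).indicator (gg s ρ b) (fun k l => H (Equiv.swap 0 x.1 k) (Equiv.swap 0 x.2 l)) := by
        apply lintegral_mono
        intro H
        obtain ⟨i, j, hij⟩ := exists_norm_entry H
        refine le_trans ?_ (Finset.single_le_sum (f := fun x : Fin (p+1) × Fin (q+1) =>
          ({H | ‖H 0 0‖ = ‖H‖}).indicator (gg s ρ b) (fun k l => H (Equiv.swap 0 x.1 k) (Equiv.swap 0 x.2 l)))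
          (fun _ _ => zero_le) (Finset.mem_univ (i, j)))
        have h0 : ‖(fun k l => H (Equiv.swap 0 i k) (Equiv.swap 0 j l))‖ = ‖H‖ := by
          apply le_antisymm
          · rw [pi_norm_le_iff_of_nonneg (norm_nonneg _)]; intro k
            rw [pi_norm_le_iff_of_nonneg (norm_nonneg _)]; intro l
            exact (norm_le_pi_norm (H _) _).trans (norm_le_pi_norm H _)
          · rw [← hij]
            have h1 := norm_le_pi_norm (fun k l => H (Equiv.swap 0 i k) (Equiv.swap 0 j l)) 0
            have h2 := norm_le_pi_norm (fun l => H (Equiv.swap 0 i 0) (Equiv.swap 0 j l)) 0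
            simp only [Equiv.swap_apply_left] at h1 h2
            exact h2.trans h1
        rw [Set.indicator_of_mem, gg_swap]
        simp only [Set.mem_ofPred_eq, h0, Equiv.swap_apply_left, hij]
    _ = ∑ x : Fin (p+1) × Fin (q+1), ∫⁻ H : Fin (p+1) → Fin (q+1) → ℂ, 
          ({H | ‖H 0 0‖ = ‖H‖}).indicator (gg s ρ b) (fun k l => H (Equiv.swap 0 x.1 k) (Equiv.swap 0 x.2 l)) := by
        rw [lintegral_finsetSum]
        intro x _
        exact hmeas.comp (mp_swap (Equiv.swap 0 x.1) (Equiv.swap 0 x.2)).measurable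
    _ = _ := by
        rw [Finset.sum_congr rfl (fun x _ => key x.1 x.2)]
        simp

lemma lintegral_cplx {κ b : ℝ} (hκ : 0 < κ) (hb : 0 < b) :
    ∫⁻ a : ℂ, ENNReal.ofReal (‖a‖ ^ (2 * κ - 2) * Real.exp (-b * ‖a‖ ^ 2))
      = ENNReal.ofReal (Real.pi * Real.Gamma κ * b ^ (-κ)) := by
  have h := Complex.integral_rpow_mul_exp_neg_mul_rpow (p := 2) (q := 2 * κ - 2) (b := b) (by norm_num)
    (by linarith) hb
  have e1 : -(2 * κ - 2 + 2) / 2 = -κ := by ring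
  have e2 : (2 * κ - 2 + 2) / 2 = κ := by ring
  rw [e1, e2] at h
  simp only [Real.rpow_two] at h
  have hpos : 0 < (2 * Real.pi / 2) * b ^ (-κ) * Real.Gamma κ := by
    have := Real.Gamma_pos_of_pos hκ
    positivity
  have hIntg : Integrable (fun a : ℂ => ‖a‖ ^ (2 * κ - 2) * Real.exp (-b * ‖a‖ ^ 2)) := by
    by_contra hc
    rw [integral_undef hc] at h
    linarith
  rw [← ofReal_integral_eq_lintegral_ofReal hIntg]
  · rw [h]; congr 1; ring
  · exact Filter.Eventually.of_forall fun a => by positivity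

lemma upper_bound (s : ℝ) (hs : 0 ≤ s) (d : ℕ → ℝ) : ∀ p q : ℕ,
    (∀ j < min p q, 0 ≤ d j ∧ d j ≤ s ∧ d j < 2 * (j : ℝ) + 1 + |(p : ℝ) - q|) →
    ∃ C : ℝ, 0 < C ∧ ∀ ρ b : ℝ, 0 < ρ → 0 < b →
      ∫⁻ H : Fin p → Fin q → ℂ, gg s ρ b H ≤ ENNReal.ofReal
        (C * ρ ^ (-(∑ j ∈ Finset.range (min p q), d j))
          * b ^ (-((p : ℝ) * q - ∑ j ∈ Finset.range (min p q), d j))) := by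
  intro p
  have base : ∀ p q : ℕ, (p = 0 ∨ q = 0) → ∃ C : ℝ, 0 < C ∧ ∀ ρ b : ℝ, 0 < ρ → 0 < b →
      ∫⁻ H : Fin p → Fin q → ℂ, gg s ρ b H ≤ ENNReal.ofReal
        (C * ρ ^ (-(∑ j ∈ Finset.range (min p q), d j))
          * b ^ (-((p : ℝ) * q - ∑ j ∈ Finset.range (min p q), d j))) := by
    intro p q h
    refine ⟨1, one_pos, fun ρ b hρ hb => ?_⟩
    have hmin : min p q = 0 := by rcases h with rfl | rfl <;> simp
    have hpq : (p : ℝ) * q = 0 := by rcases h with rfl | rfl <;> simp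
    rw [hmin, hpq]
    simp only [Finset.range_zero, Finset.sum_empty, sub_zero, neg_zero, Real.rpow_zero, mul_one, ENNReal.ofReal_one]
    calc ∫⁻ H : Fin p → Fin q → ℂ, gg s ρ b H ≤ ∫⁻ H : Fin p → Fin q → ℂ, 1 := by
          apply lintegral_mono
          intro H
          unfold gg
          rw [ENNReal.ofReal_le_one]
          have h1 : Real.exp (-b * ‖H‖ ^ 2) ≤ 1 := by
            rw [Real.exp_le_one_iff]; nlinarith [sq_nonneg ‖H‖]
          have h2 : ff ρ (Matrix.of H) ^ (-s) ≤ 1 := Real.rpow_le_one_of_one_le_of_nonpos (one_le_ff hρ.le _) (by linarith)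
          have h3 : 0 ≤ ff ρ (Matrix.of H) ^ (-s) := Real.rpow_nonneg (zero_le_one.trans (one_le_ff hρ.le _)) _
          exact mul_le_one₀ h1 h3 h2
      _ = 1 := by rw [lintegral_one, vol_univ_zero p q h]
  induction p with
  | zero => intro q _; exact base 0 q (Or.inl rfl)
  | succ p ih =>
    intro q
    cases q with
    | zero => intro _; exact base _ 0 (Or.inr rfl)
    | succ q =>
      intro hd
      have hmin : min (p+1) (q+1) = min p q + 1 := by omega
      rw [hmin] at hd ⊢
      have habs : |((p+1 : ℕ) : ℝ) - ((q+1 : ℕ) : ℝ)| = |(p : ℝ) - q| := by push_cast; congr 1; ring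
      rw [habs] at hd
      obtain ⟨C, hC, hI⟩ := ih q (fun j hj => hd j (by omega))
      obtain ⟨κ, hκ, hff⟩ := ff_asm p q
      set D := ∑ j ∈ Finset.range (min p q), d j with hD
      have hDle : D ≤ (p : ℝ) * q := by
        rw [← sum_w p q]
        exact Finset.sum_le_sum fun j hj => (hd j (by have := Finset.mem_range.mp hj; omega)).2.2.le
      obtain ⟨u0, us, uw⟩ := hd (min p q) (by omega)
      rw [w_last] at uw
      rw [Finset.sum_range_succ, ← hD]
      set u := d (min p q)
      have hτ : 0 < ((p+1 : ℕ) : ℝ) * ((q+1 : ℕ) : ℝ) - (D + u) := by push_cast; nlinarith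
      set τ := ((p+1 : ℕ) : ℝ) * ((q+1 : ℕ) : ℝ) - (D + u) with hτd
      set A : ℝ := Real.exp 1 * κ ^ s * Real.pi ^ q * Real.pi ^ p * C * 4 ^ ((p : ℝ) * q - D) with hA
      have hA0 : 0 < A := by positivity
      refine ⟨((p+1 : ℕ) * (q+1 : ℕ) : ℝ) * (A * (Real.pi * Real.Gamma τ)), ?_, ?_⟩
      · have := Real.Gamma_pos_of_pos hτ; positivity
      intro ρ b hρ hb
      refine (gg_pivot s ρ b).trans ?_
      have hsplit : ENNReal.ofReal (((p+1 : ℕ) * (q+1 : ℕ) : ℝ) * (A * (Real.pi * Real.Gamma τ)) *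
          ρ ^ (-(D + u)) * b ^ (-τ)) = ((p+1 : ℕ) * (q+1 : ℕ) : ENNReal) *
            ENNReal.ofReal (A * (Real.pi * Real.Gamma τ) * (ρ ^ (-(D + u)) * b ^ (-τ))) := by
        rw [← ENNReal.ofReal_natCast (p+1), ← ENNReal.ofReal_natCast (q+1),
          ← ENNReal.ofReal_mul (by positivity), ← ENNReal.ofReal_mul (by positivity)]
        congr 1; ring
      rw [hsplit]
      refine mul_le_mul' le_rfl ?_
      have hm : MeasurableSet {H : Fin (p+1) → Fin (q+1) → ℂ | ‖H 0 0‖ = ‖H‖} :=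
        (isClosed_eq (by fun_prop) (by fun_prop)).measurableSet
      rw [lintegral_asm' ((measurable_gg s ρ b).indicator hm)]
      have hfin : ∫⁻ a : ℂ, ENNReal.ofReal (A * ρ ^ (-(D + u))) * ENNReal.ofReal (‖a‖ ^ (2 * τ - 2) * Real.exp (-b * ‖a‖ ^ 2))
          = ENNReal.ofReal (A * (Real.pi * Real.Gamma τ) * (ρ ^ (-(D + u)) * b ^ (-τ))) := by
        rw [lintegral_const_mul' _ _ ENNReal.ofReal_ne_top, lintegral_cplx hτ hb, ← ENNReal.ofReal_mul (by positivity)]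
        congr 1; ring
      rw [← hfin]
      apply lintegral_mono_ae
      have hne : ∀ᵐ a : ℂ, a ≠ 0 := by
        rw [ae_iff]; simp
      filter_upwards [hne] with a ha
      have ha' : 0 < ‖a‖ := norm_pos_iff.mpr ha
      set k : ℝ := Real.exp 1 * κ ^ s * (ρ * ‖a‖ ^ 2) ^ (-u) * Real.exp (-b * ‖a‖ ^ 2) with hk
      have hk0 : 0 ≤ k := by positivity
      -- pointwise bound
      have hpt : ∀ (b' : Fin q → ℂ) (c : Fin p → ℂ) (D' : Fin p → Fin q → ℂ),
          ({H : Fin (p+1) → Fin (q+1) → ℂ | ‖H 0 0‖ = ‖H‖}).indicator (gg s ρ b)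
            (asm a b' c (fun i j => D' i j + c i * b' j / a)) ≤
          (Metric.closedBall (0 : Fin q → ℂ) ‖a‖).indicator 1 b' *
            ((Metric.closedBall (0 : Fin p → ℂ) ‖a‖).indicator 1 c *
              (ENNReal.ofReal k * gg s ρ (1 / (4 * ‖a‖ ^ 2)) D')) := by
        intro b' c D'
        by_cases hmem : asm a b' c (fun i j => D' i j + c i * b' j / a) ∈
          {H : Fin (p+1) → Fin (q+1) → ℂ | ‖H 0 0‖ = ‖H‖}
        swap
        · rw [Set.indicator_of_notMem hmem]; exact zero_le
        rw [Set.indicator_of_mem hmem]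
        have hn : ‖a‖ = ‖asm a b' c (fun i j => D' i j + c i * b' j / a)‖ := hmem
        have hent : ∀ i j, ‖asm a b' c (fun i j => D' i j + c i * b' j / a) i j‖ ≤ ‖a‖ := by
          intro i j
          conv_rhs => rw [hn]
          exact (norm_le_pi_norm (asm a b' c (fun i j => D' i j + c i * b' j / a) i) j).trans (norm_le_pi_norm _ i)
        have hb' : ∀ j, ‖b' j‖ ≤ ‖a‖ := fun j => by simpa [asm] using hent 0 j.succ
        have hc' : ∀ i, ‖c i‖ ≤ ‖a‖ := fun i => by simpa [asm] using hent i.succ 0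
        have hDD : ∀ i j, ‖D' i j‖ ≤ 2 * ‖a‖ := fun i j => by
          have h1 : ‖D' i j + c i * b' j / a‖ ≤ ‖a‖ := by simpa [asm] using hent i.succ j.succ
          have h2 : ‖c i * b' j / a‖ ≤ ‖a‖ := by
            rw [norm_div, norm_mul, div_le_iff₀ ha']
            exact mul_le_mul (hc' i) (hb' j) (norm_nonneg _) (norm_nonneg _)
          calc ‖D' i j‖ = ‖(D' i j + c i * b' j / a) - c i * b' j / a‖ := by congr 1; ring
            _ ≤ ‖a‖ + ‖a‖ := (norm_sub_le _ _).trans (add_le_add h1 h2)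
            _ = _ := by ring
        have hDn : ‖D'‖ ≤ 2 * ‖a‖ := by
          rw [pi_norm_le_iff_of_nonneg (by positivity)]; intro i
          rw [pi_norm_le_iff_of_nonneg (by positivity)]; intro j
          exact hDD i j
        have m1 : b' ∈ Metric.closedBall (0 : Fin q → ℂ) ‖a‖ := by
          rw [mem_closedBall_zero_iff, pi_norm_le_iff_of_nonneg (norm_nonneg _)]; exact hb'
        have m2 : c ∈ Metric.closedBall (0 : Fin p → ℂ) ‖a‖ := by
          rw [mem_closedBall_zero_iff, pi_norm_le_iff_of_nonneg (norm_nonneg _)]; exact hc'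
        rw [Set.indicator_of_mem m1, Set.indicator_of_mem m2, Pi.one_apply, Pi.one_apply, one_mul, one_mul]
        unfold gg
        rw [← ENNReal.ofReal_mul hk0, ← hn]
        apply ENNReal.ofReal_le_ofReal
        have hf1 := one_le_ff hρ.le (Matrix.of D')
        have hfull := one_le_ff hρ.le (Matrix.of (asm a b' c (fun i j => D' i j + c i * b' j / a)))
        have hlow := (hff ρ hρ.le a b' c D' ha (fun j => (hb' j).trans (by linarith)) (fun j => (hc' j).trans (by linarith))).2
        have hx : 0 < ρ * ‖a‖ ^ 2 := by positivity
        have r1 : ff ρ (Matrix.of (asm a b' c (fun i j => D' i j + c i * b' j / a))) ^ (-s) ≤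
            κ ^ s * ((ρ * ‖a‖ ^ 2) ^ (-u) * ff ρ (Matrix.of D') ^ (-s)) := by
          have h1 : (κ * ff ρ (Matrix.of (asm a b' c (fun i j => D' i j + c i * b' j / a)))) ^ (-s) ≤
              ((1 + ρ * ‖a‖ ^ 2) * ff ρ (Matrix.of D')) ^ (-s) :=
            Real.rpow_le_rpow_of_nonpos (by positivity) hlow (by linarith)
          rw [Real.mul_rpow hκ.le (by linarith), Real.mul_rpow (by positivity) (by linarith)] at h1
          have h2 : (1 + ρ * ‖a‖ ^ 2) ^ (-s) ≤ (ρ * ‖a‖ ^ 2) ^ (-u) :=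
            (Real.rpow_le_rpow_of_exponent_le (by linarith) (by linarith : -s ≤ -u)).trans
              (Real.rpow_le_rpow_of_nonpos hx (by linarith) (by linarith))
          have h3 : κ ^ s * κ ^ (-s) = 1 := by rw [← Real.rpow_add hκ]; simp
          have h4 : 0 ≤ ff ρ (Matrix.of D') ^ (-s) := Real.rpow_nonneg (by linarith) _
          calc _ = κ ^ s * (κ ^ (-s) * ff ρ (Matrix.of (asm a b' c (fun i j => D' i j + c i * b' j / a))) ^ (-s)) := by
                rw [← mul_assoc, h3, one_mul]
            _ ≤ κ ^ s * ((1 + ρ * ‖a‖ ^ 2) ^ (-s) * ff ρ (Matrix.of D') ^ (-s)) := by gcongr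
            _ ≤ _ := by gcongr
        have r2 : 1 ≤ Real.exp 1 * Real.exp (-(1 / (4 * ‖a‖ ^ 2)) * ‖D'‖ ^ 2) := by
          rw [← Real.exp_add, Real.one_le_exp_iff]
          have : (1 / (4 * ‖a‖ ^ 2)) * ‖D'‖ ^ 2 ≤ 1 := by
            rw [div_mul_eq_mul_div, one_mul, div_le_one (by positivity)]
            calc ‖D'‖ ^ 2 ≤ (2 * ‖a‖) ^ 2 := by gcongr
              _ = _ := by ring
          linarith
        have h4 : 0 ≤ ff ρ (Matrix.of D') ^ (-s) := Real.rpow_nonneg (by linarith) _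
        calc _ ≤ Real.exp (-b * ‖a‖ ^ 2) * (κ ^ s * ((ρ * ‖a‖ ^ 2) ^ (-u) * ff ρ (Matrix.of D') ^ (-s))) := by gcongr
          _ ≤ (Real.exp (-b * ‖a‖ ^ 2) * (κ ^ s * ((ρ * ‖a‖ ^ 2) ^ (-u) * ff ρ (Matrix.of D') ^ (-s)))) *
              (Real.exp 1 * Real.exp (-(1 / (4 * ‖a‖ ^ 2)) * ‖D'‖ ^ 2)) :=
            le_mul_of_one_le_right (by positivity) r2
          _ = _ := by rw [hk]; ring
      have hE : ENNReal.ofReal (C * ρ ^ (-D) * (1 / (4 * ‖a‖ ^ 2)) ^ (-((p : ℝ) * q - D))) ≠ ⊤ := ENNReal.ofReal_ne_top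
      calc _ ≤ ∫⁻ b' : Fin q → ℂ, ∫⁻ c : Fin p → ℂ, ∫⁻ D' : Fin p → Fin q → ℂ,
            (Metric.closedBall (0 : Fin q → ℂ) ‖a‖).indicator 1 b' *
            ((Metric.closedBall (0 : Fin p → ℂ) ‖a‖).indicator 1 c *
              (ENNReal.ofReal k * gg s ρ (1 / (4 * ‖a‖ ^ 2)) D')) := by
            refine lintegral_mono fun b' => lintegral_mono fun c => lintegral_mono fun D' => hpt b' c D'
        _ ≤ ∫⁻ b' : Fin q → ℂ, ∫⁻ c : Fin p → ℂ, 
            (Metric.closedBall (0 : Fin q → ℂ) ‖a‖).indicator 1 b' *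
            ((Metric.closedBall (0 : Fin p → ℂ) ‖a‖).indicator 1 c *
              (ENNReal.ofReal k * ENNReal.ofReal (C * ρ ^ (-D) * (1 / (4 * ‖a‖ ^ 2)) ^ (-((p : ℝ) * q - D))))) := by
            refine lintegral_mono fun b' => lintegral_mono fun c => ?_
            have t1 : (Metric.closedBall (0 : Fin q → ℂ) ‖a‖).indicator (1 : (Fin q → ℂ) → ENNReal) b' ≠ ⊤ := by
              classical rw [Set.indicator_apply]; split_ifs <;> simp
            have t2 : (Metric.closedBall (0 : Fin p → ℂ) ‖a‖).indicator (1 : (Fin p → ℂ) → ENNReal) c ≠ ⊤ := by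
              classical rw [Set.indicator_apply]; split_ifs <;> simp
            simp only []
            rw [lintegral_const_mul' _ _ t1, lintegral_const_mul' _ _ t2, lintegral_const_mul' _ _ ENNReal.ofReal_ne_top]
            gcongr
            exact hI ρ _ hρ (by positivity)
        _ = volume (Metric.closedBall (0 : Fin q → ℂ) ‖a‖) * (volume (Metric.closedBall (0 : Fin p → ℂ) ‖a‖) *
             (ENNReal.ofReal k * ENNReal.ofReal (C * ρ ^ (-D) * (1 / (4 * ‖a‖ ^ 2)) ^ (-((p : ℝ) * q - D))))) := by
            have i1 : ∀ b' : Fin q → ℂ, ∫⁻ c : Fin p → ℂ, 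
              (Metric.closedBall (0 : Fin q → ℂ) ‖a‖).indicator 1 b' *
              ((Metric.closedBall (0 : Fin p → ℂ) ‖a‖).indicator 1 c *
              (ENNReal.ofReal k * ENNReal.ofReal (C * ρ ^ (-D) * (1 / (4 * ‖a‖ ^ 2)) ^ (-((p : ℝ) * q - D)))))
              = (Metric.closedBall (0 : Fin q → ℂ) ‖a‖).indicator 1 b' * (volume (Metric.closedBall (0 : Fin p → ℂ) ‖a‖) *
                (ENNReal.ofReal k * ENNReal.ofReal (C * ρ ^ (-D) * (1 / (4 * ‖a‖ ^ 2)) ^ (-((p : ℝ) * q - D))))) := by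
              intro b'
              rw [lintegral_const_mul _ (by exact (measurable_one.indicator Metric.isClosed_closedBall.measurableSet).mul_const _),
                lintegral_mul_const _ (measurable_one.indicator Metric.isClosed_closedBall.measurableSet),
                lintegral_indicator_one Metric.isClosed_closedBall.measurableSet]
            simp only [i1]
            rw [lintegral_mul_const _ (measurable_one.indicator Metric.isClosed_closedBall.measurableSet),
                lintegral_indicator_one Metric.isClosed_closedBall.measurableSet]
        _ = _ := by
            rw [vol_closedBall q (norm_nonneg a), vol_closedBall p (norm_nonneg a), ← ENNReal.ofReal_mul hk0,
              ← ENNReal.ofReal_mul (by positivity), ← ENNReal.ofReal_mul (by positivity), ← ENNReal.ofReal_mul (by positivity)]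
            congr 1
            have ea : ∀ x : ℝ, (‖a‖ ^ 2) ^ x = ‖a‖ ^ (2 * x) := fun x => by
              rw [← Real.rpow_natCast ‖a‖ 2, ← Real.rpow_mul ha'.le]; norm_num
            have f1 : (1 / (4 * ‖a‖ ^ 2)) ^ (-((p : ℝ) * q - D)) = 4 ^ ((p : ℝ) * q - D) * ‖a‖ ^ (2 * ((p : ℝ) * q - D)) := by
              rw [one_div, Real.inv_rpow (by positivity), ← Real.rpow_neg (by positivity), neg_neg,
                Real.mul_rpow (by norm_num) (by positivity), ea]
            have f2 : (ρ * ‖a‖ ^ 2) ^ (-u) = ρ ^ (-u) * ‖a‖ ^ (2 * (-u)) := by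
              rw [Real.mul_rpow hρ.le (by positivity), ea]
            have f3 : (Real.pi * ‖a‖ ^ 2) ^ q = Real.pi ^ q * ‖a‖ ^ (2 * (q : ℝ)) := by
              rw [mul_pow, ← ea, Real.rpow_natCast]
            have f4 : (Real.pi * ‖a‖ ^ 2) ^ p = Real.pi ^ p * ‖a‖ ^ (2 * (p : ℝ)) := by
              rw [mul_pow, ← ea, Real.rpow_natCast]
            have f5 : ρ ^ (-(D + u)) = ρ ^ (-D) * ρ ^ (-u) := by rw [← Real.rpow_add hρ]; congr 1; ring
            have f6 : ‖a‖ ^ (2 * τ - 2) = ‖a‖ ^ (2 * ((p : ℝ) * q - D)) * ‖a‖ ^ (2 * (-u)) * ‖a‖ ^ (2 * (q : ℝ)) * ‖a‖ ^ (2 * (p : ℝ)) := by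
              rw [← Real.rpow_add ha', ← Real.rpow_add ha', ← Real.rpow_add ha']
              congr 1; rw [hτd]; push_cast; ring
            rw [f3, f4, f5, f6, hk, f2, f1, hA]
            ring

open MeasureTheory ProbabilityTheory

lemma measurableSet_lowset {p q : ℕ} (ρ B X : ℝ) :
    MeasurableSet {H : Fin p → Fin q → ℂ | ‖H‖ ≤ B ∧ ff ρ (Matrix.of H) ≤ X} :=
  ((isClosed_le continuous_norm continuous_const).inter
    (isClosed_le (continuous_ff ρ) continuous_const)).measurableSet

lemma lower_bound (α : ℕ → ℝ) (hα : ∀ j, 0 ≤ α j) : ∀ p q : ℕ,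
    ∃ B K c : ℝ, 0 < B ∧ 0 < K ∧ 0 < c ∧ ∀ ρ : ℝ, 1 ≤ ρ →
      ENNReal.ofReal (c * ρ ^ (-(∑ j ∈ Finset.range (min p q), (2 * (j : ℝ) + 1 + |(p : ℝ) - q|) * α j))) ≤
        volume {H : Fin p → Fin q → ℂ | ‖H‖ ≤ B ∧ ff ρ (Matrix.of H) ≤
          K * ρ ^ (∑ j ∈ Finset.range (min p q), max (1 - α j) 0)} := by
  intro p
  have base : ∀ p q : ℕ, (p = 0 ∨ q = 0) → ∃ B K c : ℝ, 0 < B ∧ 0 < K ∧ 0 < c ∧ ∀ ρ : ℝ, 1 ≤ ρ →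
      ENNReal.ofReal (c * ρ ^ (-(∑ j ∈ Finset.range (min p q), (2 * (j : ℝ) + 1 + |(p : ℝ) - q|) * α j))) ≤
        volume {H : Fin p → Fin q → ℂ | ‖H‖ ≤ B ∧ ff ρ (Matrix.of H) ≤
          K * ρ ^ (∑ j ∈ Finset.range (min p q), max (1 - α j) 0)} := by
    intro p q h
    refine ⟨1, 1, 1, one_pos, one_pos, one_pos, fun ρ hρ => ?_⟩
    have hmin : min p q = 0 := by rcases h with rfl | rfl <;> simp
    rw [hmin]
    simp only [Finset.range_zero, Finset.sum_empty, neg_zero, Real.rpow_zero, mul_one, ENNReal.ofReal_one]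
    rw [← vol_univ_zero p q h]
    apply measure_mono
    intro H _
    have hz : H = 0 := by
      rcases h with rfl | rfl
      · ext i; exact i.elim0
      · ext i j; exact j.elim0
    subst hz
    refine ⟨by simp, ?_⟩
    have : ff ρ (Matrix.of (0 : Fin p → Fin q → ℂ)) = 1 := by
      have : (Matrix.of (0 : Fin p → Fin q → ℂ)) = 0 := rfl
      rw [this]; simp [ff]
    exact this.le
  induction p with
  | zero => intro q; exact base 0 q (Or.inl rfl)
  | succ p ih =>
    intro q
    cases q with
    | zero => exact base _ 0 (Or.inr rfl)
    | succ q =>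
      have hmin : min (p+1) (q+1) = min p q + 1 := by omega
      have habs : |((p+1 : ℕ) : ℝ) - ((q+1 : ℕ) : ℝ)| = |(p : ℝ) - q| := by push_cast; congr 1; ring
      rw [hmin, habs]
      simp only [Finset.sum_range_succ, w_last]
      obtain ⟨B, K, c, hB, hK, hc, hI⟩ := ih q
      obtain ⟨κ, hκ, hff⟩ := ff_asm p q
      refine ⟨B + 2, 2 * κ * K, Real.pi / 16 * Real.pi ^ q * Real.pi ^ p * c, by positivity, by positivity, by positivity, ?_⟩
      intro ρ hρ
      have hρ0 : 0 < ρ := by linarith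
      have hI' := hI ρ hρ
      set D := ∑ j ∈ Finset.range (min p q), (2 * (j : ℝ) + 1 + |(p : ℝ) - q|) * α j
      set S := ∑ j ∈ Finset.range (min p q), max (1 - α j) 0
      have hβ := hα (min p q)
      set β := α (min p q)
      set t : ℝ := ρ ^ (-β / 2) with ht
      have ht0 : 0 < t := by positivity
      have ht1 : t ≤ 1 := Real.rpow_le_one_of_one_le_of_nonpos hρ (by linarith)
      have ht2 : t ^ 2 = ρ ^ (-β) := by
        rw [ht, ← Real.rpow_natCast, ← Real.rpow_mul hρ0.le]; congr 1; push_cast; ring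
      set E' := {H : Fin (p+1) → Fin (q+1) → ℂ | ‖H‖ ≤ B + 2 ∧ ff ρ (Matrix.of H) ≤
          2 * κ * K * ρ ^ (S + max (1 - β) 0)} with hE'
      set E := {H : Fin p → Fin q → ℂ | ‖H‖ ≤ B ∧ ff ρ (Matrix.of H) ≤ K * ρ ^ S} with hE
      have hm' : MeasurableSet E' := measurableSet_lowset _ _ _
      have hm : MeasurableSet E := measurableSet_lowset _ _ _
      rw [← lintegral_indicator_one hm', lintegral_asm' (measurable_one.indicator hm')]
      have hpt : ∀ (a : ℂ) (b : Fin q → ℂ) (c : Fin p → ℂ) (D' : Fin p → Fin q → ℂ),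
          (Metric.closedBall ((3 * t / 4 : ℝ) : ℂ) (t/4)).indicator (1 : ℂ → ENNReal) a *
            ((Metric.closedBall (0 : Fin q → ℂ) t).indicator 1 b *
            ((Metric.closedBall (0 : Fin p → ℂ) t).indicator 1 c * E.indicator 1 D')) ≤
          E'.indicator 1 (asm a b c (fun i j => D' i j + c i * b j / a)) := by
        intro a b c D'
        by_cases h1 : a ∈ Metric.closedBall ((3 * t / 4 : ℝ) : ℂ) (t/4)
        swap
        · rw [Set.indicator_of_notMem h1, zero_mul]; exact zero_le
        by_cases h2 : b ∈ Metric.closedBall (0 : Fin q → ℂ) t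
        swap
        · simp [Set.indicator_of_notMem h2]
        by_cases h3 : c ∈ Metric.closedBall (0 : Fin p → ℂ) t
        swap
        · simp [Set.indicator_of_notMem h3]
        by_cases h4 : D' ∈ E
        swap
        · simp [Set.indicator_of_notMem h4]
        rw [Set.indicator_of_mem h1, Set.indicator_of_mem h2, Set.indicator_of_mem h3, Set.indicator_of_mem h4]
        rw [Set.indicator_of_mem]
        · simp
        rw [mem_closedBall_iff_norm] at h1
        have n3 : ‖((3 * t / 4 : ℝ) : ℂ)‖ = 3 * t / 4 := by
          rw [Complex.norm_real, Real.norm_of_nonneg (by positivity)]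
        have ha1 : ‖a‖ ≤ t := by
          have := norm_le_norm_add_norm_sub' a ((3 * t / 4 : ℝ) : ℂ)
          linarith
        have ha2 : t / 2 ≤ ‖a‖ := by
          have := norm_le_norm_add_norm_sub a ((3 * t / 4 : ℝ) : ℂ)
          linarith
        have ha0 : 0 < ‖a‖ := by linarith
        rw [mem_closedBall_zero_iff, pi_norm_le_iff_of_nonneg ht0.le] at h2 h3
        have hcb : ∀ i j, ‖c i * b j / a‖ ≤ 2 := by
          intro i j
          rw [norm_div, norm_mul, div_le_iff₀ ha0]
          calc ‖c i‖ * ‖b j‖ ≤ t * t := mul_le_mul (h3 i) (h2 j) (norm_nonneg _) ht0.le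
            _ ≤ t * 1 := by gcongr
            _ ≤ _ := by linarith
        constructor
        · rw [pi_norm_le_iff_of_nonneg (by positivity)]; intro i
          rw [pi_norm_le_iff_of_nonneg (by positivity)]; intro j
          refine Fin.cases ?_ (fun i => ?_) i <;> refine Fin.cases ?_ (fun j => ?_) j
          · simp [asm]; linarith
          · simp [asm]; linarith [h2 j]
          · simp [asm]; linarith [h3 i]
          · simp only [asm, Fin.cons_succ]
            refine (norm_add_le _ _).trans (add_le_add ?_ (hcb i j))
            exact (norm_le_pi_norm (D' i) j).trans ((norm_le_pi_norm D' i).trans h4.1)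
        · have h := (hff ρ hρ0.le a b c D' (norm_pos_iff.mp ha0) (fun j => (h2 j).trans (by linarith))
            (fun j => (h3 j).trans (by linarith))).1
          refine h.trans ?_
          have e1 : 1 + ρ * ‖a‖ ^ 2 ≤ 2 * ρ ^ (max (1 - β) 0) := by
            have g1 : ρ * ‖a‖ ^ 2 ≤ ρ ^ (1 - β) := by
              calc ρ * ‖a‖ ^ 2 ≤ ρ * t ^ 2 := by gcongr
                _ = _ := by rw [ht2, sub_eq_add_neg, Real.rpow_add hρ0, Real.rpow_one]
            have g2 : ρ ^ (1 - β) ≤ ρ ^ (max (1 - β) 0) := Real.rpow_le_rpow_of_exponent_le hρ (le_max_left _ _)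
            have g3 : 1 ≤ ρ ^ (max (1 - β) 0) := Real.one_le_rpow hρ (le_max_right _ _)
            linarith
          have e2 := h4.2
          have e3 := one_le_ff hρ0.le (Matrix.of D')
          calc κ * ((1 + ρ * ‖a‖ ^ 2) * ff ρ (Matrix.of D')) ≤ κ * ((2 * ρ ^ (max (1 - β) 0)) * (K * ρ ^ S)) := by
                gcongr
            _ = _ := by rw [Real.rpow_add hρ0]; ring
      calc _ ≤ volume (Metric.closedBall ((3 * t / 4 : ℝ) : ℂ) (t/4)) * (volume (Metric.closedBall (0 : Fin q → ℂ) t) *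
            (volume (Metric.closedBall (0 : Fin p → ℂ) t) * volume E)) := by
            rw [vol_closedBall q ht0.le, vol_closedBall p ht0.le]
            have hv : volume (Metric.closedBall ((3 * t / 4 : ℝ) : ℂ) (t/4)) = ENNReal.ofReal (Real.pi * (t/4)^2) := by
              rw [Complex.volume_closedBall, ENNReal.ofReal_mul Real.pi_pos.le, mul_comm, ENNReal.ofReal_pow (by positivity)]
              congr 1
              exact (ENNReal.ofReal_coe_nnreal (p := NNReal.pi)).symm
            rw [hv]
            refine le_trans ?_ (mul_le_mul' le_rfl (mul_le_mul' le_rfl (mul_le_mul' le_rfl hI')))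
            rw [← ENNReal.ofReal_mul (by positivity), ← ENNReal.ofReal_mul (by positivity), ← ENNReal.ofReal_mul (by positivity)]
            apply le_of_eq
            congr 1
            have e1 : ρ ^ (-(D + ((p:ℝ) + q + 1) * β)) = ρ ^ (-β) * ((ρ ^ (-β)) ^ q * ((ρ ^ (-β)) ^ p * ρ ^ (-D))) := by
              rw [← Real.rpow_natCast, ← Real.rpow_natCast, ← Real.rpow_mul hρ0.le, ← Real.rpow_mul hρ0.le,
                ← Real.rpow_add hρ0, ← Real.rpow_add hρ0, ← Real.rpow_add hρ0]
              congr 1; ring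
            rw [e1, div_pow, mul_pow, mul_pow, ht2]
            ring
        _ = ∫⁻ a : ℂ, ∫⁻ b : Fin q → ℂ, ∫⁻ c : Fin p → ℂ, ∫⁻ D' : Fin p → Fin q → ℂ, 
            (Metric.closedBall ((3 * t / 4 : ℝ) : ℂ) (t/4)).indicator (1 : ℂ → ENNReal) a *
            ((Metric.closedBall (0 : Fin q → ℂ) t).indicator 1 b *
            ((Metric.closedBall (0 : Fin p → ℂ) t).indicator 1 c * E.indicator 1 D')) := by
            have m1 : Measurable ((Metric.closedBall ((3 * t / 4 : ℝ) : ℂ) (t/4)).indicator (1 : ℂ → ENNReal)) :=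
              measurable_one.indicator Metric.isClosed_closedBall.measurableSet
            have m2 : Measurable ((Metric.closedBall (0 : Fin q → ℂ) t).indicator (1 : (Fin q → ℂ) → ENNReal)) :=
              measurable_one.indicator Metric.isClosed_closedBall.measurableSet
            have m3 : Measurable ((Metric.closedBall (0 : Fin p → ℂ) t).indicator (1 : (Fin p → ℂ) → ENNReal)) :=
              measurable_one.indicator Metric.isClosed_closedBall.measurableSet
            have m4 : Measurable (E.indicator (1 : (Fin p → Fin q → ℂ) → ENNReal)) :=
              measurable_one.indicator hm
            have i4 : ∀ x y z : ENNReal, ∫⁻ D' : Fin p → Fin q → ℂ, x * (y * (z * E.indicator 1 D')) =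
              x * (y * (z * volume E)) := by
              intro x y z
              rw [lintegral_const_mul _ (by fun_prop), lintegral_const_mul _ (by fun_prop), lintegral_const_mul _ m4,
                lintegral_indicator_one hm]
            simp only [i4]
            have i3 : ∀ x y : ENNReal, ∫⁻ c : Fin p → ℂ, x * (y * ((Metric.closedBall (0 : Fin p → ℂ) t).indicator 1 c * volume E)) =
              x * (y * (volume (Metric.closedBall (0 : Fin p → ℂ) t) * volume E)) := by
              intro x y
              rw [lintegral_const_mul _ (by fun_prop), lintegral_const_mul _ (by fun_prop), lintegral_mul_const _ m3,
                lintegral_indicator_one Metric.isClosed_closedBall.measurableSet]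
            simp only [i3]
            have i2 : ∀ x y : ENNReal, ∫⁻ c : Fin q → ℂ, x * ((Metric.closedBall (0 : Fin q → ℂ) t).indicator 1 c * y) =
              x * (volume (Metric.closedBall (0 : Fin q → ℂ) t) * y) := by
              intro x y
              rw [lintegral_const_mul _ (by fun_prop), lintegral_mul_const _ m2,
                lintegral_indicator_one Metric.isClosed_closedBall.measurableSet]
            simp only [i2]
            rw [lintegral_mul_const _ m1, lintegral_indicator_one Metric.isClosed_closedBall.measurableSet]
        _ ≤ _ := by
            refine lintegral_mono fun a => lintegral_mono fun b' => lintegral_mono fun c => lintegral_mono fun D' => hpt a b' c D'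

open MeasureTheory ProbabilityTheory

lemma lintegral_pi_prod {E : Type} [MeasureSpace E] [SigmaFinite (volume : Measure E)] : ∀ {n : ℕ}
    (w : Fin n → E → ENNReal), (∀ i, Measurable (w i)) →
    ∫⁻ x : Fin n → E, ∏ i, w i (x i) = ∏ i, ∫⁻ a, w i a := by
  intro n
  induction n with
  | zero =>
    intro w hw
    simp [volume_pi]
  | succ n ih =>
    intro w hw
    rw [lintegral_cons (by fun_prop), Fin.prod_univ_succ, ← ih _ (fun i => hw i.succ)]
    simp only [Fin.prod_univ_succ, Fin.cons_zero, Fin.cons_succ]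
    rw [← lintegral_mul_const _ (hw 0)]
    refine lintegral_congr fun a => ?_
    rw [lintegral_const_mul _ (by fun_prop)]

lemma pi_density {E : Type} [MeasureSpace E] [SigmaFinite (volume : Measure E)] (n : ℕ)
    (ν : Measure E) [SigmaFinite ν] (w : E → ENNReal) (hw : Measurable w)
    (hν : ν = volume.withDensity w) :
    Measure.pi (fun _ : Fin n => ν) = volume.withDensity (fun x => ∏ i, w (x i)) := by
  classical
  apply Measure.pi_eq
  intro s hs
  have hS : MeasurableSet (Set.univ.pi s) := MeasurableSet.univ_pi hs
  rw [withDensity_apply _ hS, ← lintegral_indicator hS]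
  have : ∀ x : Fin n → E, (Set.univ.pi s).indicator (fun x => ∏ i, w (x i)) x = ∏ i, (s i).indicator w (x i) := by
    intro x
    by_cases hx : x ∈ Set.univ.pi s
    · rw [Set.indicator_of_mem hx]
      exact Finset.prod_congr rfl fun i _ => (Set.indicator_of_mem (hx i (Set.mem_univ i)) _).symm
    · rw [Set.indicator_of_notMem hx]
      simp only [Set.mem_pi, Set.mem_univ, true_imp_iff, not_forall] at hx
      obtain ⟨i, hi⟩ := hx
      exact (Finset.prod_eq_zero (Finset.mem_univ i) (Set.indicator_of_notMem hi _)).symm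
  simp only [this]
  rw [lintegral_pi_prod (fun i => (s i).indicator w) (fun i => hw.indicator (hs i))]
  refine Finset.prod_congr rfl fun i _ => ?_
  rw [lintegral_indicator (hs i), hν, withDensity_apply _ (hs i)]

/-- standard complex Gaussian law -/
noncomputable def cG : Measure ℂ :=
  ((gaussianReal 0 (1/2)).prod (gaussianReal 0 (1/2))).map Complex.measurableEquivRealProd.symm

instance : IsProbabilityMeasure cG :=
  Measure.isProbabilityMeasure_map (Complex.measurableEquivRealProd.symm.measurable.aemeasurable)

lemma cG_box (s t : Set ℝ) :
    cG {z | z.re ∈ s ∧ z.im ∈ t} = gaussianReal 0 (1/2) s * gaussianReal 0 (1/2) t := by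
  rw [cG, MeasurableEquiv.map_apply, ← Measure.prod_prod]
  rfl

noncomputable def wG (z : ℂ) : ENNReal := ENNReal.ofReal (Real.pi⁻¹ * Real.exp (-‖z‖ ^ 2))

lemma measurable_wG : Measurable wG := by
  unfold wG; fun_prop

lemma cG_density : cG = volume.withDensity wG := by
  have hw : ∀ x y : ℝ, gaussianPDF 0 (1/2) x * gaussianPDF 0 (1/2) y = wG ⟨x, y⟩ := by
    intro x y
    rw [gaussianPDF, gaussianPDF, ← ENNReal.ofReal_mul (gaussianPDFReal_nonneg _ _ _), wG]
    congr 1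
    rw [gaussianPDFReal, gaussianPDFReal]
    have e1 : (2 * Real.pi * ((1/2 : NNReal) : ℝ)) = Real.pi := by push_cast; ring
    rw [e1]
    have e2 : ‖(⟨x, y⟩ : ℂ)‖ ^ 2 = x ^ 2 + y ^ 2 := by
      rw [← Complex.normSq_eq_norm_sq, Complex.normSq_mk]; ring
    rw [e2]
    have e3 : Real.pi⁻¹ = (√Real.pi)⁻¹ * (√Real.pi)⁻¹ := by
      rw [← mul_inv, Real.mul_self_sqrt Real.pi_pos.le]
    have e4 : Real.exp (-(x ^ 2 + y ^ 2)) = Real.exp (-(x - 0) ^ 2 / (2 * ((1/2 : NNReal) : ℝ))) *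
        Real.exp (-(y - 0) ^ 2 / (2 * ((1/2 : NNReal) : ℝ))) := by
      rw [← Real.exp_add]; congr 1; push_cast; ring
    rw [e3, e4]; ring
  rw [cG, gaussianReal_of_var_ne_zero 0 (by norm_num), prod_withDensity (by fun_prop) (by fun_prop)]
  ext s hs
  rw [MeasurableEquiv.map_apply, withDensity_apply _ hs, withDensity_apply _ (Complex.measurableEquivRealProd.symm.measurable hs)]
  rw [← (Complex.volume_preserving_equiv_real_prod.symm).setLIntegral_comp_preimage hs measurable_wG]
  rw [← Measure.volume_eq_prod]
  refine lintegral_congr fun a => ?_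
  rw [hw]; rfl

/-- Gaussian matrix law -/
noncomputable def mG (p q : ℕ) : Measure (Fin p → Fin q → ℂ) :=
  Measure.pi (fun _ => Measure.pi (fun _ => cG))

instance (p q : ℕ) : IsProbabilityMeasure (mG p q) := by unfold mG; infer_instance

lemma mG_density (p q : ℕ) :
    mG p q = volume.withDensity (fun H => ∏ i, ∏ j, wG (H i j)) := by
  have hm := measurable_wG
  have h1 := pi_density q cG wG measurable_wG cG_density
  have hmw : Measurable (fun x : Fin q → ℂ => ∏ j, wG (x j)) := by fun_prop
  unfold mG
  rw [pi_density (E := Fin q → ℂ) p (Measure.pi (fun _ : Fin q => cG)) (fun x => ∏ j, wG (x j)) hmw h1]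

lemma wG_prod_le (p q : ℕ) (H : Fin p → Fin q → ℂ) :
    ∏ i, ∏ j, wG (H i j) ≤ ENNReal.ofReal (Real.exp (-1 * ‖H‖ ^ 2)) := by
  have hle : ∀ z, wG z ≤ 1 := by
    intro z
    rw [wG, ENNReal.ofReal_le_one]
    have h1 : Real.exp (-‖z‖ ^ 2) ≤ 1 := by rw [Real.exp_le_one_iff]; nlinarith [sq_nonneg ‖z‖]
    have h2 : Real.pi⁻¹ ≤ 1 := inv_le_one_of_one_le₀ (by linarith [Real.pi_gt_three])
    exact mul_le_one₀ h2 (Real.exp_pos _).le h1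
  have hle2 : ∀ z, wG z ≤ ENNReal.ofReal (Real.exp (-1 * ‖z‖ ^ 2)) := by
    intro z
    rw [wG]
    apply ENNReal.ofReal_le_ofReal
    have h2 : Real.pi⁻¹ ≤ 1 := inv_le_one_of_one_le₀ (by linarith [Real.pi_gt_three])
    rw [neg_one_mul]
    exact mul_le_of_le_one_left (Real.exp_pos _).le h2
  cases p with
  | zero => 
    have : H = 0 := by ext i; exact i.elim0
    subst this; simp
  | succ p =>
    cases q with
    | zero =>
      have : H = 0 := by ext i j; exact j.elim0
      subst this; simp
    | succ q =>
      obtain ⟨i, j, hij⟩ := exists_norm_entry H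
      rw [← hij]
      refine le_trans ?_ (hle2 _)
      calc ∏ i, ∏ j, wG (H i j) ≤ ∏ j, wG (H i j) := by
            rw [← Finset.mul_prod_erase _ _ (Finset.mem_univ i)]
            exact mul_le_of_le_one_right' (Finset.prod_le_one' fun _ _ => Finset.prod_le_one' fun _ _ => hle _)
        _ ≤ _ := by
            rw [← Finset.mul_prod_erase _ _ (Finset.mem_univ j)]
            exact mul_le_of_le_one_right' (Finset.prod_le_one' fun _ _ => hle _)

lemma mG_chernoff {p q : ℕ} (s : ℝ) (ρ : ℝ) :
    ∫⁻ H, ENNReal.ofReal (ff ρ (Matrix.of H) ^ (-s)) ∂(mG p q) ≤ ∫⁻ H : Fin p → Fin q → ℂ, gg s ρ 1 H := by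
  have hm := measurable_wG
  rw [mG_density, lintegral_withDensity_eq_lintegral_mul _ (by fun_prop)]
  · apply lintegral_mono
    intro H
    rw [gg, ENNReal.ofReal_mul (Real.exp_pos _).le]
    exact mul_le_mul' (wG_prod_le p q H) le_rfl
  · exact ((continuous_ff ρ).measurable.pow_const _).ennreal_ofReal

lemma mG_lower {p q : ℕ} (B : ℝ) : ∃ c : ℝ, 0 < c ∧ ∀ A : Set (Fin p → Fin q → ℂ), MeasurableSet A →
    (∀ H ∈ A, ‖H‖ ≤ B) → ENNReal.ofReal c * volume A ≤ mG p q A := by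
  refine ⟨(Real.pi⁻¹ * Real.exp (-B ^ 2)) ^ (p * q), by positivity, fun A hA hB => ?_⟩
  rw [mG_density, withDensity_apply _ hA, ← setLIntegral_const]
  apply setLIntegral_mono' hA
  intro H hH
  have h1 : ∀ i j, ENNReal.ofReal (Real.pi⁻¹ * Real.exp (-B ^ 2)) ≤ wG (H i j) := by
    intro i j
    rw [wG]
    apply ENNReal.ofReal_le_ofReal
    have : ‖H i j‖ ≤ B := (norm_le_pi_norm (H i) j).trans ((norm_le_pi_norm H i).trans (hB H hH))
    gcongr
  calc ENNReal.ofReal ((Real.pi⁻¹ * Real.exp (-B ^ 2)) ^ (p * q)) = ∏ i : Fin p, ∏ j : Fin q, ENNReal.ofReal (Real.pi⁻¹ * Real.exp (-B ^ 2)) := by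
        simp only [Finset.prod_const, Finset.card_univ, Fintype.card_fin]
        rw [← pow_mul, ENNReal.ofReal_pow (by positivity), mul_comm q p]
    _ ≤ _ := Finset.prod_le_prod' fun i _ => Finset.prod_le_prod' fun j _ => h1 i j

open MeasureTheory ProbabilityTheory

/-- coordinates: complex matrices to real vector -/
noncomputable def toVec {N a b c d : ℕ} (x : (Fin N → Fin a → Fin b → ℂ) × (Fin N → Fin c → Fin d → ℂ)) :
    (((Fin N × Fin a × Fin b) ⊕ (Fin N × Fin c × Fin d)) × Bool) → ℝ :=
  fun p => Sum.elim
          (fun q => if p.2 then (x.1 q.1 q.2.1 q.2.2).re else (x.1 q.1 q.2.1 q.2.2).im)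
          (fun q => if p.2 then (x.2 q.1 q.2.1 q.2.2).re else (x.2 q.1 q.2.1 q.2.2).im)
          p.1

noncomputable def ofVec {N a b c d : ℕ} (v : (((Fin N × Fin a × Fin b) ⊕ (Fin N × Fin c × Fin d)) × Bool) → ℝ) :
    (Fin N → Fin a → Fin b → ℂ) × (Fin N → Fin c → Fin d → ℂ) :=
  (fun l i j => Complex.measurableEquivRealProd.symm (v (Sum.inl (l, i, j), true), v (Sum.inl (l, i, j), false)),
   fun l i j => Complex.measurableEquivRealProd.symm (v (Sum.inr (l, i, j), true), v (Sum.inr (l, i, j), false)))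

lemma ofVec_toVec {N a b c d : ℕ} (x : (Fin N → Fin a → Fin b → ℂ) × (Fin N → Fin c → Fin d → ℂ)) :
    ofVec (toVec x) = x := by
  refine Prod.ext ?_ ?_
  · funext l i j
    simp [ofVec, toVec]
  · funext l i j
    simp [ofVec, toVec]

lemma measurable_ofVec {N a b c d : ℕ} : Measurable (ofVec (N := N) (a := a) (b := b) (c := c) (d := d)) := by
  unfold ofVec
  apply Measurable.prodMk
  · rw [measurable_pi_iff]; intro l; rw [measurable_pi_iff]; intro i; rw [measurable_pi_iff]; intro j
    exact Complex.measurableEquivRealProd.symm.measurable.comp (by fun_prop)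
  · rw [measurable_pi_iff]; intro l; rw [measurable_pi_iff]; intro i; rw [measurable_pi_iff]; intro j
    exact Complex.measurableEquivRealProd.symm.measurable.comp (by fun_prop)

lemma measurable_toVec {N a b c d : ℕ} : Measurable (toVec (N := N) (a := a) (b := b) (c := c) (d := d)) := by
  rw [measurable_pi_iff]
  rintro ⟨q | q, t⟩
  · cases t
    · have : (fun x : (Fin N → Fin a → Fin b → ℂ) × (Fin N → Fin c → Fin d → ℂ) => toVec x (Sum.inl q, false)) =
        fun x => (x.1 q.1 q.2.1 q.2.2).im := by funext x; simp [toVec]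
      rw [this]; exact Complex.measurable_im.comp (by fun_prop)
    · have : (fun x : (Fin N → Fin a → Fin b → ℂ) × (Fin N → Fin c → Fin d → ℂ) => toVec x (Sum.inl q, true)) =
        fun x => (x.1 q.1 q.2.1 q.2.2).re := by funext x; simp [toVec]
      rw [this]; exact Complex.measurable_re.comp (by fun_prop)
  · cases t
    · have : (fun x : (Fin N → Fin a → Fin b → ℂ) × (Fin N → Fin c → Fin d → ℂ) => toVec x (Sum.inr q, false)) =
        fun x => (x.2 q.1 q.2.1 q.2.2).im := by funext x; simp [toVec]
      rw [this]; exact Complex.measurable_im.comp (by fun_prop)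
    · have : (fun x : (Fin N → Fin a → Fin b → ℂ) × (Fin N → Fin c → Fin d → ℂ) => toVec x (Sum.inr q, true)) =
        fun x => (x.2 q.1 q.2.1 q.2.2).re := by funext x; simp [toVec]
      rw [this]; exact Complex.measurable_re.comp (by fun_prop)

noncomputable def bigM (N a b c d : ℕ) : Measure ((Fin N → Fin a → Fin b → ℂ) × (Fin N → Fin c → Fin d → ℂ)) :=
  (Measure.pi (fun _ : Fin N => mG a b)).prod (Measure.pi (fun _ : Fin N => mG c d))

lemma map_toVec (N a b c d : ℕ) :
    Measure.pi (fun _ => gaussianReal 0 (1/2)) = (bigM N a b c d).map toVec := by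
  apply Measure.pi_eq
  intro s hs
  rw [Measure.map_apply measurable_toVec (MeasurableSet.univ_pi hs)]
  have hpre : toVec (N := N) (a := a) (b := b) (c := c) (d := d) ⁻¹' (Set.univ.pi s) =
      (Set.univ.pi fun l => Set.univ.pi fun i => Set.univ.pi fun j =>
        {z : ℂ | z.re ∈ s (Sum.inl (l, i, j), true) ∧ z.im ∈ s (Sum.inl (l, i, j), false)}) ×ˢ
      (Set.univ.pi fun l => Set.univ.pi fun i => Set.univ.pi fun j =>
        {z : ℂ | z.re ∈ s (Sum.inr (l, i, j), true) ∧ z.im ∈ s (Sum.inr (l, i, j), false)}) := by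
    ext x
    constructor
    · intro h
      have h' : ∀ i, toVec x i ∈ s i := fun i => h i (Set.mem_univ i)
      refine ⟨fun l _ i _ j _ => ⟨?_, ?_⟩, fun l _ i _ j _ => ⟨?_, ?_⟩⟩
      · simpa [toVec] using h' (Sum.inl (l, i, j), true)
      · simpa [toVec] using h' (Sum.inl (l, i, j), false)
      · simpa [toVec] using h' (Sum.inr (l, i, j), true)
      · simpa [toVec] using h' (Sum.inr (l, i, j), false)
    · rintro ⟨h1, h2⟩
      rintro ⟨⟨l, i, j⟩ | ⟨l, i, j⟩, t⟩ -
      · have := h1 l trivial i trivial j trivial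
        cases t
        · simpa [toVec] using this.2
        · simpa [toVec] using this.1
      · have := h2 l trivial i trivial j trivial
        cases t
        · simpa [toVec] using this.2
        · simpa [toVec] using this.1
  rw [hpre, bigM, Measure.prod_prod]
  simp only [mG, Measure.pi_pi, cG_box]
  simp only [Fintype.prod_prod_type, Fintype.prod_sum_type, Fintype.prod_bool]

lemma law_H {Ω : Type*} [MeasurableSpace Ω] (P : Measure Ω) [IsProbabilityMeasure P]
    (M1 M2 M3 : ℕ) (L : ℕ) 
    (H1 : ℕ → Ω → Matrix (Fin M2) (Fin M1) ℂ) (H2 : ℕ → Ω → Matrix (Fin M3) (Fin M2) ℂ)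
    (hGauss : Measure.map
      (fun ω (p : ((Fin (L+1) × Fin M2 × Fin M1) ⊕ (Fin (L+1) × Fin M3 × Fin M2)) × Bool) =>
        Sum.elim
          (fun q => if p.2 then (H1 q.1 ω q.2.1 q.2.2).re else (H1 q.1 ω q.2.1 q.2.2).im)
          (fun q => if p.2 then (H2 q.1 ω q.2.1 q.2.2).re else (H2 q.1 ω q.2.1 q.2.2).im)
          p.1) P
      = Measure.pi (fun _ => gaussianReal 0 (1/2)))
    (A1 : ℕ → Set (Fin M2 → Fin M1 → ℂ)) (A2 : ℕ → Set (Fin M3 → Fin M2 → ℂ))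
    (hA1 : ∀ l, MeasurableSet (A1 l)) (hA2 : ∀ l, MeasurableSet (A2 l)) :
    P {ω | ∀ l < L, (fun i j => H1 l ω i j) ∈ A1 l ∧ (fun i j => H2 l ω i j) ∈ A2 l} =
      (∏ l ∈ Finset.range L, mG M2 M1 (A1 l)) * (∏ l ∈ Finset.range L, mG M3 M2 (A2 l)) := by
  set Y : Ω → (Fin (L+1) → Fin M2 → Fin M1 → ℂ) × (Fin (L+1) → Fin M3 → Fin M2 → ℂ) :=
    fun ω => (fun l i j => H1 l ω i j, fun l i j => H2 l ω i j) with hY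
  have hX : (fun ω (p : ((Fin (L+1) × Fin M2 × Fin M1) ⊕ (Fin (L+1) × Fin M3 × Fin M2)) × Bool) =>
        Sum.elim
          (fun q => if p.2 then (H1 q.1 ω q.2.1 q.2.2).re else (H1 q.1 ω q.2.1 q.2.2).im)
          (fun q => if p.2 then (H2 q.1 ω q.2.1 q.2.2).re else (H2 q.1 ω q.2.1 q.2.2).im)
          p.1) = fun ω => toVec (Y ω) := rfl
  rw [hX] at hGauss
  have hae : AEMeasurable (fun ω => toVec (Y ω)) P := by
    apply AEMeasurable.of_map_ne_zero
    rw [hGauss]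
    exact IsProbabilityMeasure.ne_zero _
  have hYae : AEMeasurable Y P := by
    have := measurable_ofVec.comp_aemeasurable hae
    have e : (ofVec ∘ fun ω => toVec (Y ω)) = Y := by
      funext ω; exact ofVec_toVec _
    rwa [e] at this
  have hlaw : P.map Y = bigM (L+1) M2 M1 M3 M2 := by
    have e : (ofVec ∘ fun ω => toVec (Y ω)) = Y := by
      funext ω; exact ofVec_toVec _
    rw [← e, ← AEMeasurable.map_map_of_aemeasurable measurable_ofVec.aemeasurable hae, hGauss, map_toVec,
      Measure.map_map measurable_ofVec measurable_toVec]
    have e2 : (ofVec ∘ toVec : (Fin (L+1) → Fin M2 → Fin M1 → ℂ) × (Fin (L+1) → Fin M3 → Fin M2 → ℂ) → _) = id := by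
      funext x; exact ofVec_toVec x
    rw [e2, Measure.map_id]
  have hset : {ω | ∀ l < L, (fun i j => H1 l ω i j) ∈ A1 l ∧ (fun i j => H2 l ω i j) ∈ A2 l} =
      Y ⁻¹' ((Set.univ.pi fun l : Fin (L+1) => if (l : ℕ) < L then A1 l else Set.univ) ×ˢ
        (Set.univ.pi fun l : Fin (L+1) => if (l : ℕ) < L then A2 l else Set.univ)) := by
    ext ω
    constructor
    · intro h
      refine ⟨fun l _ => ?_, fun l _ => ?_⟩
      · show _ ∈ if (l : ℕ) < L then A1 l else Set.univ
        split_ifs with hl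
        · exact (h l hl).1
        · trivial
      · show _ ∈ if (l : ℕ) < L then A2 l else Set.univ
        split_ifs with hl
        · exact (h l hl).2
        · trivial
    · rintro ⟨h1, h2⟩ l hl
      have g1 := h1 ⟨l, by omega⟩ trivial
      have g2 := h2 ⟨l, by omega⟩ trivial
      simp only [hl, if_true] at g1 g2
      exact ⟨g1, g2⟩
  have m1 : MeasurableSet (Set.univ.pi fun l : Fin (L+1) => if (l : ℕ) < L then A1 l else Set.univ) := by
    apply MeasurableSet.univ_pi; intro l; split_ifs; exacts [hA1 _, MeasurableSet.univ]
  have m2 : MeasurableSet (Set.univ.pi fun l : Fin (L+1) => if (l : ℕ) < L then A2 l else Set.univ) := by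
    apply MeasurableSet.univ_pi; intro l; split_ifs; exacts [hA2 _, MeasurableSet.univ]
  rw [hset, ← Measure.map_apply_of_aemeasurable hYae (m1.prod m2), hlaw, bigM, Measure.prod_prod,
    Measure.pi_pi, Measure.pi_pi]
  congr 1
  · rw [Fin.prod_univ_castSucc, Finset.prod_range]
    simp
  · rw [Fin.prod_univ_castSucc, Finset.prod_range]
    simp

open MeasureTheory ProbabilityTheory

lemma sum_clip (x : ℝ) (hx : 0 ≤ x) (n : ℕ) :
    ∑ j ∈ Finset.range n, min 1 (max 0 (x - j)) = min x n := by
  induction n with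
  | zero => simp [hx]
  | succ n ih =>
    rw [Finset.sum_range_succ, ih]
    push_cast
    rcases le_total x n with h | h
    · rw [min_eq_left h, max_eq_left (by linarith), min_eq_right (by norm_num), min_eq_left (by linarith)]; ring
    · rw [min_eq_right h, max_eq_right (by linarith)]
      rcases le_total x (n+1) with h' | h'
      · rw [min_eq_right (by linarith), min_eq_left h']; ring
      · rw [min_eq_left (by linarith), min_eq_right h']

/-- optimal exponents -/
noncomputable def al (m : ℕ) (c : ℝ) (j : ℕ) : ℝ := min 1 (max 0 ((m : ℝ) - c - j))

lemma al_nonneg (m : ℕ) (c : ℝ) (j : ℕ) : 0 ≤ al m c j := le_min zero_le_one (le_max_left _ _)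
lemma al_le_one (m : ℕ) (c : ℝ) (j : ℕ) : al m c j ≤ 1 := min_le_left _ _
lemma al_anti (m : ℕ) (c : ℝ) {j k : ℕ} (h : j ≤ k) : al m c k ≤ al m c j := by
  have : (j : ℝ) ≤ k := by exact_mod_cast h
  unfold al; gcongr

lemma sum_al (m : ℕ) (c : ℝ) (hc : 0 ≤ c) (hm : c ≤ m) : ∑ j ∈ Finset.range m, al m c j = m - c := by
  unfold al
  rw [sum_clip _ (by linarith), min_eq_left (by linarith)]

lemma sum_one_sub_al (m : ℕ) (c : ℝ) (hc : 0 ≤ c) (hm : c ≤ m) :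
    ∑ j ∈ Finset.range m, max (1 - al m c j) 0 = c := by
  have : ∀ j, max (1 - al m c j) 0 = 1 - al m c j := fun j => max_eq_left (by linarith [al_le_one m c j])
  simp only [this, Finset.sum_sub_distrib, sum_al m c hc hm]
  simp

lemma al_lip (m : ℕ) (c δ : ℝ) (hδ : 0 ≤ δ) (j : ℕ) : al m c j ≤ al m (c + δ) j + δ := by
  unfold al
  rcases le_total 0 ((m : ℝ) - c - j) with h | h
  · have : max 0 ((m : ℝ) - c - j) ≤ max 0 ((m : ℝ) - (c + δ) - j) + δ := by
      rw [max_eq_right h]; linarith [le_max_right 0 ((m : ℝ) - (c + δ) - j)]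
    rcases le_total 1 (max 0 ((m : ℝ) - (c + δ) - j)) with h1 | h1
    · rw [min_eq_left h1]; exact (min_le_left _ _).trans (by linarith)
    · rw [min_eq_right h1]; exact (min_le_right _ _).trans this
  · rw [max_eq_left h, min_eq_right zero_le_one]
    have : 0 ≤ min 1 (max 0 ((m : ℝ) - (c + δ) - j)) := le_min zero_le_one (le_max_left _ _)
    linarith

/-- weights -/
noncomputable def ww (p q : ℕ) (j : ℕ) : ℝ := 2 * (j : ℝ) + 1 + |(p : ℝ) - q|

lemma ww_pos (p q j : ℕ) : 0 < ww p q j := by unfold ww; positivity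

lemma ww_mono (p q : ℕ) {j k : ℕ} (h : j ≤ k) : ww p q j ≤ ww p q k := by
  have : (j : ℝ) ≤ k := by exact_mod_cast h
  unfold ww; gcongr

lemma sum_ww (p q : ℕ) : ∑ j ∈ Finset.range (min p q), ww p q j = p * q := sum_w p q

/-- diversity of one block -/
noncomputable def dd (p q : ℕ) (c : ℝ) : ℝ := ∑ j ∈ Finset.range (min p q), ww p q j * al (min p q) c j

lemma dd_lip (p q : ℕ) (c δ : ℝ) (hδ : 0 ≤ δ) : dd p q c ≤ dd p q (c + δ) + p * q * δ := by
  rw [← sum_ww, Finset.sum_mul]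
  unfold dd
  rw [← Finset.sum_add_distrib]
  refine Finset.sum_le_sum fun j _ => ?_
  rw [← mul_add]
  exact mul_le_mul_of_nonneg_left (al_lip _ _ _ hδ _) (ww_pos _ _ _).le

lemma dd_big (p q : ℕ) (c : ℝ) (hc : (min p q : ℕ) ≤ c) : dd p q c = 0 := by
  unfold dd
  refine Finset.sum_eq_zero fun j _ => ?_
  have : al (min p q) c j = 0 := by
    unfold al
    have : (0 : ℝ) ≤ j := by positivity
    rw [max_eq_left (by linarith), min_eq_right zero_le_one]
  rw [this, mul_zero]

lemma exists_s (p q : ℕ) (c : ℝ) (hc : 0 ≤ c) : ∃ s : ℝ, 0 ≤ s ∧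
    dd p q c = (∑ j ∈ Finset.range (min p q), min (ww p q j) s) - c * s := by
  by_cases hm : (min p q : ℕ) ≤ c
  · refine ⟨0, le_rfl, ?_⟩
    rw [dd_big p q c hm]
    simp only [min_eq_right (ww_pos _ _ _).le]
    simp
  · rw [not_le] at hm
    set m := min p q with hmd
    have hfl : ⌊c⌋₊ < m := by
      rw [Nat.floor_lt hc]; exact hm
    set j0 := m - 1 - ⌊c⌋₊ with hj0
    have hj0' : (j0 : ℝ) = m - 1 - ⌊c⌋₊ := by
      have : j0 + 1 + ⌊c⌋₊ = m := by omega
      have h : (j0 : ℝ) + 1 + ⌊c⌋₊ = m := by exact_mod_cast this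
      linarith
    have f1 := Nat.floor_le hc
    have f2 := Nat.lt_floor_add_one c
    refine ⟨ww p q j0, (ww_pos _ _ _).le, ?_⟩
    have key : ∀ j ∈ Finset.range m, min (ww p q j) (ww p q j0) = ww p q j * al m c j + ww p q j0 * (1 - al m c j) := by
      intro j _
      rcases lt_trichotomy j j0 with h | h | h
      · have h' : (j : ℝ) + 1 ≤ j0 := by exact_mod_cast h
        have : al m c j = 1 := by
          unfold al; apply min_eq_left; apply le_max_of_le_right; linarith
        rw [this, min_eq_left (ww_mono p q h.le)]; ring
      · subst h; rw [min_self]; ring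
      · have h' : (j0 : ℝ) + 1 ≤ j := by exact_mod_cast h
        have : al m c j = 0 := by
          unfold al
          rw [max_eq_left (by linarith), min_eq_right zero_le_one]
        rw [this, min_eq_right (ww_mono p q h.le)]; ring
    rw [Finset.sum_congr rfl key, Finset.sum_add_distrib, ← Finset.mul_sum, Finset.sum_sub_distrib,
      sum_al m c hc hm.le]
    simp only [Finset.sum_const, Finset.card_range, nsmul_eq_mul, mul_one]
    unfold dd
    rw [← hmd]
    ring

lemma chernoff (p q M : ℕ) (hM : 0 < M) (c : ℝ) (hc : 0 ≤ c) (ε : ℝ) (hε : 0 < ε) :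
    ∃ C : ℝ, 0 < C ∧ ∀ ρ : ℝ, 1 < ρ →
      mG p q {H | ff (ρ / M) (Matrix.of H) ≤ ρ ^ c} ≤ ENNReal.ofReal (C * ρ ^ (-(dd p q c) + ε)) := by
  obtain ⟨s, hs, hdd⟩ := exists_s p q c hc
  set η : ℝ := ε / (p * q + ε) with hη
  have hpq : (0 : ℝ) ≤ p * q := by positivity
  have hη0 : 0 < η := by positivity
  have hη1 : η ≤ 1 := by rw [hη, div_le_one (by positivity)]; linarith
  have hηe : η * (p * q) ≤ ε := by
    rw [hη, div_mul_eq_mul_div, div_le_iff₀ (by positivity)]; nlinarith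
  by_cases hs0 : s = 0
  · -- trivial case
    have h0 : dd p q c = 0 := by
      rw [hdd, hs0]
      simp [min_eq_right (ww_pos _ _ _).le]
    refine ⟨1, one_pos, fun ρ hρ => prob_le_one.trans ?_⟩
    rw [h0, ENNReal.one_le_ofReal, one_mul]
    exact Real.one_le_rpow hρ.le (by linarith)
  have hs' : 0 < s := lt_of_le_of_ne hs (Ne.symm hs0)
  set d : ℕ → ℝ := fun j => (1 - η) * min (ww p q j) s with hd
  obtain ⟨C, hC, hI⟩ := upper_bound s hs d p q (by
    intro j _
    have h1 : 0 < min (ww p q j) s := lt_min (ww_pos _ _ _) hs'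
    refine ⟨mul_nonneg (by linarith) h1.le, ?_, ?_⟩
    · calc (1 - η) * min (ww p q j) s ≤ 1 * min (ww p q j) s := by gcongr; linarith
        _ ≤ s := by rw [one_mul]; exact min_le_right _ _
    · calc (1 - η) * min (ww p q j) s < 1 * min (ww p q j) s := by gcongr; linarith
        _ ≤ ww p q j := by rw [one_mul]; exact min_le_left _ _)
  set D := ∑ j ∈ Finset.range (min p q), d j with hD
  have hDe : c * s - D ≤ -(dd p q c) + ε := by
    have e1 : D = (1 - η) * ∑ j ∈ Finset.range (min p q), min (ww p q j) s := by
      rw [hD, Finset.mul_sum]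
    have e2 : ∑ j ∈ Finset.range (min p q), min (ww p q j) s ≤ p * q := by
      rw [← sum_ww]; exact Finset.sum_le_sum fun j _ => min_le_left _ _
    have e3 : η * ∑ j ∈ Finset.range (min p q), min (ww p q j) s ≤ η * (p * q) := by gcongr
    rw [e1, hdd]; linarith
  have hM' : (0 : ℝ) < M := by exact_mod_cast hM
  refine ⟨C * (M : ℝ) ^ D, by positivity, fun ρ hρ => ?_⟩
  have hρ0 : 0 < ρ := by linarith
  have hρM : 0 < ρ / M := by positivity
  have hmeas : Measurable (fun H : Fin p → Fin q → ℂ => ENNReal.ofReal (ff (ρ / M) (Matrix.of H) ^ (-s))) :=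
    ((continuous_ff (ρ / M)).measurable.pow_const _).ennreal_ofReal
  have hmark := mul_meas_ge_le_lintegral (μ := mG p q) hmeas (ENNReal.ofReal ((ρ ^ c) ^ (-s)))
  have hb := (mG_chernoff s (ρ / M)).trans (hI (ρ / M) 1 hρM one_pos)
  rw [Real.one_rpow, mul_one] at hb
  have hsub : {H : Fin p → Fin q → ℂ | ff (ρ / M) (Matrix.of H) ≤ ρ ^ c} ⊆
      {H | ENNReal.ofReal ((ρ ^ c) ^ (-s)) ≤ ENNReal.ofReal (ff (ρ / M) (Matrix.of H) ^ (-s))} := by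
    intro H hH
    apply ENNReal.ofReal_le_ofReal
    exact Real.rpow_le_rpow_of_nonpos (lt_of_lt_of_le one_pos (one_le_ff hρM.le _)) hH (by linarith)
  have hkey : ENNReal.ofReal ((ρ ^ c) ^ (-s)) * mG p q {H | ff (ρ / M) (Matrix.of H) ≤ ρ ^ c} ≤
      ENNReal.ofReal (C * (ρ / M) ^ (-D)) :=
    (mul_le_mul' le_rfl (measure_mono hsub)).trans (hmark.trans hb)
  have hcan : ENNReal.ofReal ((ρ ^ c) ^ s) * ENNReal.ofReal ((ρ ^ c) ^ (-s)) = 1 := by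
    rw [← ENNReal.ofReal_mul (by positivity), ← Real.rpow_add (by positivity)]; simp
  calc mG p q {H | ff (ρ / M) (Matrix.of H) ≤ ρ ^ c} 
      = ENNReal.ofReal ((ρ ^ c) ^ s) * (ENNReal.ofReal ((ρ ^ c) ^ (-s)) * mG p q {H | ff (ρ / M) (Matrix.of H) ≤ ρ ^ c}) := by
        rw [← mul_assoc, hcan, one_mul]
    _ ≤ ENNReal.ofReal ((ρ ^ c) ^ s) * ENNReal.ofReal (C * (ρ / M) ^ (-D)) := mul_le_mul' le_rfl hkey
    _ = ENNReal.ofReal (C * M ^ D * ρ ^ (c * s - D)) := by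
        rw [← ENNReal.ofReal_mul (by positivity)]
        congr 1
        rw [Real.div_rpow hρ0.le hM'.le, Real.rpow_neg hM'.le, div_inv_eq_mul, ← Real.rpow_mul hρ0.le,
          sub_eq_add_neg, Real.rpow_add hρ0]
        ring
    _ ≤ _ := by
        apply ENNReal.ofReal_le_ofReal
        have := Real.rpow_le_rpow_of_exponent_le hρ.le hDe
        gcongr

/-- grid cell -/
def cell (p q M K : ℕ) (δ ρ : ℝ) (k : ℕ) : Set (Fin p → Fin q → ℂ) :=
  {H | k = K ∨ ff (ρ / M) (Matrix.of H) ≤ ρ ^ ((k + 1) * δ)}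

lemma measurableSet_cell (p q M K : ℕ) (δ ρ : ℝ) (k : ℕ) : MeasurableSet (cell p q M K δ ρ k) := by
  unfold cell
  by_cases h : k = K
  · simp [h]
  · simp only [h, false_or]
    exact (isClosed_le (continuous_ff _) continuous_const).measurableSet

lemma cell_bound (p q M N : ℕ) (hM : 0 < M) (hN : 0 < N) (ε : ℝ) (hε : 0 < ε) :
    ∃ C : ℝ, 1 ≤ C ∧ ∀ k : ℕ, k ≤ N * min p q → ∀ ρ : ℝ, 1 < ρ →
      mG p q (cell p q M (N * min p q) (1 / N) ρ k) ≤
        ENNReal.ofReal (C * ρ ^ (-(dd p q (k * (1 / N))) + p * q * (1 / N) + ε)) := by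
  have hN' : (0 : ℝ) < N := by exact_mod_cast hN
  have h1 : ∀ k : ℕ, ∃ C : ℝ, 0 < C ∧ ∀ ρ : ℝ, 1 < ρ →
      mG p q {H | ff (ρ / M) (Matrix.of H) ≤ ρ ^ (((k : ℝ) + 1) * (1 / N))} ≤
        ENNReal.ofReal (C * ρ ^ (-(dd p q (((k : ℝ) + 1) * (1 / N))) + ε)) :=
    fun k => chernoff p q M hM _ (by positivity) ε hε
  choose C hC hI using h1
  have hsum : 0 ≤ ∑ k ∈ Finset.range (N * min p q + 1), C k := Finset.sum_nonneg fun k _ => (hC k).le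
  refine ⟨1 + ∑ k ∈ Finset.range (N * min p q + 1), C k, by linarith, fun k hk ρ hρ => ?_⟩
  by_cases hkK : k = N * min p q
  · refine prob_le_one.trans ?_
    have : dd p q (k * (1 / N)) = 0 := by
      apply dd_big
      rw [hkK]; push_cast
      apply le_of_eq; field_simp
    rw [this, ENNReal.one_le_ofReal, neg_zero, zero_add]
    have h2 : 1 ≤ ρ ^ ((p : ℝ) * q * (1 / N) + ε) := Real.one_le_rpow hρ.le (by positivity)
    nlinarith
  · have e : cell p q M (N * min p q) (1 / N) ρ k = {H | ff (ρ / M) (Matrix.of H) ≤ ρ ^ (((k : ℝ) + 1) * (1 / N))} := by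
      unfold cell; simp only [hkK, false_or]
    rw [e]
    refine (hI k ρ hρ).trans (ENNReal.ofReal_le_ofReal ?_)
    have hCk : C k ≤ 1 + ∑ k ∈ Finset.range (N * min p q + 1), C k := by
      have := Finset.single_le_sum (f := C) (fun k _ => (hC k).le) (Finset.mem_range.mpr (Nat.lt_succ_of_le hk))
      linarith
    have hl := dd_lip p q (k * (1 / N)) (1 / N) (by positivity)
    have e2 : (k : ℝ) * (1 / N) + 1 / N = ((k : ℝ) + 1) * (1 / N) := by ring
    rw [e2] at hl
    have hρ0 : 0 < ρ := by linarith
    have := Real.rpow_le_rpow_of_exponent_le hρ.le (show -(dd p q (((k : ℝ) + 1) * (1 / N))) + ε ≤ 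
      -(dd p q (k * (1 / N))) + p * q * (1 / N) + ε by linarith)
    gcongr

open MeasureTheory ProbabilityTheory

noncomputable def kern (f : ℕ → ℝ) (N : ℕ) (t : ℝ) : ℝ :=
  ∑ l ∈ Finset.range N, f l * min 1 (max 0 (t - l))

lemma accum_eq_kern (f : ℕ → ℝ) (N : ℕ) : ∀ t : ℝ, 0 ≤ t → t ≤ N → accum f t = kern f N t := by
  induction N with
  | zero =>
    intro t h0 h1
    have : t = 0 := le_antisymm (by simpa using h1) h0
    subst this; simp [accum, kern]
  | succ N ih =>
    intro t h0 h1
    unfold kern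
    rw [Finset.sum_range_succ]
    rcases le_or_gt t N with h | h
    · rw [max_eq_left (by linarith), min_eq_right zero_le_one, mul_zero, add_zero]
      exact ih t h0 h
    · push_cast at h1
      have hs : ∑ l ∈ Finset.range N, f l * min 1 (max 0 (t - l)) = ∑ l ∈ Finset.range N, f l := by
        refine Finset.sum_congr rfl fun l hl => ?_
        have : (l : ℝ) + 1 ≤ N := by exact_mod_cast Finset.mem_range.mp hl
        rw [max_eq_right (by linarith), min_eq_left (by linarith), mul_one]
      rw [hs, max_eq_right (by linarith), min_eq_right (by linarith)]
      unfold accum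
      rcases lt_or_eq_of_le h1 with h' | h'
      · have hf : ⌊t⌋₊ = N := by rw [Nat.floor_eq_iff h0]; exact ⟨h.le, h'⟩
        rw [hf]; ring
      · have hf : ⌊t⌋₊ = N + 1 := by
          rw [h']; exact_mod_cast Nat.floor_natCast (N+1)
        rw [hf, Finset.sum_range_succ, h']; push_cast; ring

lemma kern_mono_t (f : ℕ → ℝ) (hf : ∀ l, 0 ≤ f l) (N : ℕ) {s t : ℝ} (h : s ≤ t) : kern f N s ≤ kern f N t := by
  unfold kern
  refine Finset.sum_le_sum fun l _ => mul_le_mul_of_nonneg_left ?_ (hf l)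
  gcongr

lemma kern_mono_f (f g : ℕ → ℝ) (N : ℕ) (h : ∀ l < N, f l ≤ g l) (t : ℝ) : kern f N t ≤ kern g N t := by
  unfold kern
  refine Finset.sum_le_sum fun l hl => mul_le_mul_of_nonneg_right (h l (Finset.mem_range.mp hl)) ?_
  exact le_min zero_le_one (le_max_left _ _)

lemma kern_cont (f : ℕ → ℝ) (N : ℕ) : Continuous (kern f N) := by
  unfold kern; fun_prop

lemma kern_succ (f : ℕ → ℝ) (N : ℕ) (t : ℝ) (h : t ≤ N) : kern f (N+1) t = kern f N t := by
  unfold kern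
  rw [Finset.sum_range_succ, max_eq_left (by linarith), min_eq_right zero_le_one, mul_zero, add_zero]

lemma kern_add (f : ℕ → ℝ) (N : ℕ) (ε t : ℝ) (h0 : 0 ≤ t) (h : t ≤ N) : kern (fun l => f l + ε) N t = kern f N t + ε * t := by
  unfold kern
  simp only [add_mul, Finset.sum_add_distrib, ← Finset.mul_sum]
  rw [sum_clip t h0, min_eq_left h]

lemma kern_smul (f : ℕ → ℝ) (N : ℕ) (x t : ℝ) : kern (fun l => x * f l) N t = x * kern f N t := by
  unfold kern
  rw [Finset.mul_sum]
  exact Finset.sum_congr rfl fun l _ => by ring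

lemma fdt_nonneg (f : ℕ → ℝ) (R : ℝ) : 0 ≤ fracDecTime f R := by
  unfold fracDecTime
  apply le_sInf
  rintro x ⟨t, rfl, h0, _⟩
  exact_mod_cast h0

lemma fdt_le (f : ℕ → ℝ) (R : ℝ) (N : ℕ) (t : ℝ) (h0 : 0 ≤ t) (h1 : t ≤ N) (h : R ≤ kern f N t) :
    fracDecTime f R ≤ (t : EReal) :=
  sInf_le ⟨t, rfl, h0, by rw [accum_eq_kern f N t h0 h1]; exact h⟩

lemma fdt_attain (f : ℕ → ℝ) (hf : ∀ l, 0 ≤ f l) (R : ℝ) (N : ℕ) (h : fracDecTime f R ≤ ((N : ℝ) : EReal)) :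
    ∃ a : ℝ, 0 ≤ a ∧ a ≤ N ∧ fracDecTime f R = (a : EReal) ∧ R ≤ kern f N a := by
  have h0 := fdt_nonneg f R
  have hnt : fracDecTime f R ≠ ⊤ := ne_top_of_le_ne_top (EReal.coe_ne_top _) h
  have hnb : fracDecTime f R ≠ ⊥ := (lt_of_lt_of_le (by simp) h0).ne'
  obtain ⟨a, ha⟩ : ∃ a : ℝ, fracDecTime f R = (a : EReal) := ⟨_, (EReal.coe_toReal hnt hnb).symm⟩
  rw [ha] at h h0
  have ha0 : 0 ≤ a := by exact_mod_cast h0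
  have haN : a ≤ N := by exact_mod_cast h
  refine ⟨a, ha0, haN, ha, ?_⟩
  rw [← kern_succ f N a haN]
  have key : ∀ δ : ℝ, 0 < δ → δ ≤ 1 → R ≤ kern f (N+1) (a + δ) := by
    intro δ hδ hδ1
    have hlt : fracDecTime f R < ((a + δ : ℝ) : EReal) := by
      rw [ha]; exact_mod_cast (by linarith : a < a + δ)
    obtain ⟨x, ⟨t, rfl, ht0, htR⟩, hx⟩ := sInf_lt_iff.mp hlt
    have ht : t < a + δ := by exact_mod_cast hx
    rw [accum_eq_kern f (N+1) t ht0 (by push_cast; linarith)] at htR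
    exact htR.trans (kern_mono_t f hf _ ht.le)
  have hlim : Filter.Tendsto (fun δ : ℝ => kern f (N+1) (a + δ)) (nhdsWithin 0 (Set.Ioi 0)) (nhds (kern f (N+1) a)) := by
    have : Continuous (fun δ : ℝ => kern f (N+1) (a + δ)) := (kern_cont f (N+1)).comp (by fun_prop)
    have h2 := this.tendsto 0
    rw [add_zero] at h2
    exact h2.mono_left nhdsWithin_le_nhds
  refine ge_of_tendsto hlim ?_
  filter_upwards [Ioc_mem_nhdsGT (zero_lt_one : (0:ℝ) < 1)] with δ hδ
  exact key δ hδ.1 hδ.2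

def Bad (L : ℕ) (f g : ℕ → ℝ) (R : ℝ) : Prop :=
  ∀ s : ℝ, 0 ≤ s → s ≤ L → kern f L s < R ∨ kern g L (L - s) < R

lemma dec_iff (L : ℕ) (f g : ℕ → ℝ) (hf : ∀ l, 0 ≤ f l) (hg : ∀ l, 0 ≤ g l) (R : ℝ) :
    fracDecTime f R + fracDecTime g R > ((L : ℝ) : EReal) ↔ Bad L f g R := by
  constructor
  · intro h s h0 h1
    by_contra hc
    push Not at hc
    have e1 := fdt_le f R L s h0 h1 hc.1
    have e2 := fdt_le g R L (L - s) (by linarith) (by linarith) hc.2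
    have e3 := add_le_add e1 e2
    have : ((s : ℝ) : EReal) + ((L - s : ℝ) : EReal) = ((L : ℝ) : EReal) := by
      rw [← EReal.coe_add]; congr 1; ring
    rw [this] at e3
    exact absurd h (not_lt.mpr e3)
  · intro h
    by_contra hc
    rw [gt_iff_lt, not_lt] at hc
    have n1 := fdt_nonneg f R
    have n2 := fdt_nonneg g R
    have l1 : fracDecTime f R ≤ ((L : ℝ) : EReal) := (le_add_of_nonneg_right n2).trans hc
    have l2 : fracDecTime g R ≤ ((L : ℝ) : EReal) := (le_add_of_nonneg_left n1).trans hc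
    obtain ⟨a, a0, aL, ha, hRa⟩ := fdt_attain f hf R L l1
    obtain ⟨b, b0, bL, hb, hRb⟩ := fdt_attain g hg R L l2
    rw [ha, hb, ← EReal.coe_add] at hc
    have hab : a + b ≤ L := by exact_mod_cast hc
    rcases h a a0 aL with h | h
    · linarith
    · have := kern_mono_t g hg L (show b ≤ L - a by linarith)
      linarith

lemma Bad.mono {L : ℕ} {f g f' g' : ℕ → ℝ} {R : ℝ} (h : Bad L f g R) (hf : ∀ l < L, f' l ≤ f l) (hg : ∀ l < L, g' l ≤ g l) :
    Bad L f' g' R := by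
  intro s h0 h1
  rcases h s h0 h1 with h | h
  · exact Or.inl ((kern_mono_f _ _ _ hf s).trans_lt h)
  · exact Or.inr ((kern_mono_f _ _ _ hg _).trans_lt h)

lemma Bad.smul {L : ℕ} {f g : ℕ → ℝ} {R : ℝ} (h : Bad L f g R) {x : ℝ} (hx : 0 < x) :
    Bad L (fun l => x * f l) (fun l => x * g l) (x * R) := by
  intro s h0 h1
  rw [kern_smul, kern_smul]
  rcases h s h0 h1 with h | h
  · exact Or.inl (by gcongr)
  · exact Or.inr (by gcongr)

lemma Bad.slack {L : ℕ} {f g : ℕ → ℝ} {R : ℝ} (h : Bad L f g R) :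
    ∃ ε : ℝ, 0 < ε ∧ Bad L (fun l => f l + ε) (fun l => g l + ε) R := by
  have hcont : Continuous (fun s : ℝ => min (kern f L s) (kern g L (L - s))) :=
    (kern_cont f L).min ((kern_cont g L).comp (by fun_prop))
  have hL : (0 : ℝ) ≤ L := by positivity
  obtain ⟨s0, hs0, hmax⟩ := (isCompact_Icc (a := (0 : ℝ)) (b := L)).exists_isMaxOn ⟨0, ⟨le_rfl, hL⟩⟩ hcont.continuousOn
  have hlt : min (kern f L s0) (kern g L (L - s0)) < R := by
    rcases h s0 hs0.1 hs0.2 with h | h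
    · exact (min_le_left _ _).trans_lt h
    · exact (min_le_right _ _).trans_lt h
  set V := min (kern f L s0) (kern g L (L - s0)) with hV
  refine ⟨(R - V) / (L + 1), by apply div_pos <;> linarith, ?_⟩
  have hsm : ∀ t : ℝ, 0 ≤ t → t ≤ L → (R - V) / (L + 1) * t < R - V := by
    intro t h0 h1
    rw [div_mul_eq_mul_div, div_lt_iff₀ (by linarith)]
    apply mul_lt_mul_of_pos_left <;> linarith
  intro s h0 h1
  rw [kern_add f L _ s h0 h1, kern_add g L _ (L - s) (by linarith) (by linarith)]
  have hm : min (kern f L s) (kern g L (L - s)) ≤ V := hmax ⟨h0, h1⟩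
  rcases min_le_iff.mp hm with h | h
  · left; linarith [hsm s h0 h1]
  · right; linarith [hsm (L - s) (by linarith) (by linarith)]

open MeasureTheory ProbabilityTheory

lemma cap_eq {a b : ℕ} (M : ℕ) (ρ : ℝ) (H : Matrix (Fin a) (Fin b) ℂ) : cap M ρ H = Real.log (ff (ρ / M) H) := rfl

lemma cap_nonneg {a b : ℕ} (M : ℕ) (ρ : ℝ) (hρ : 0 ≤ ρ) (H : Matrix (Fin a) (Fin b) ℂ) : 0 ≤ cap M ρ H := by
  rw [cap_eq]; exact Real.log_nonneg (one_le_ff (by positivity) H)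

lemma final_limit (Pr : ℝ → ENNReal) (G : Set ℝ) (hne : G.Nonempty)
    (lo : ∀ x ∈ G, ∃ c : ℝ, 0 < c ∧ ∀ᶠ ρ in Filter.atTop, ENNReal.ofReal (c * ρ ^ (-x)) ≤ Pr ρ)
    (up : ∀ ε > 0, ∃ C : ℝ, 0 < C ∧ ∀ ρ : ℝ, 1 < ρ → Pr ρ ≤ ENNReal.ofReal (C * ρ ^ (-(sInf G) + ε))) :
    Filter.Tendsto (fun ρ : ℝ => Real.log (Pr ρ).toReal / Real.log ρ) Filter.atTop (nhds (-(sInf G))) := by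
  have hlog : ∀ c x : ℝ, Filter.Tendsto (fun ρ : ℝ => Real.log c / Real.log ρ + x) Filter.atTop (nhds x) := by
    intro c x
    have := (Filter.Tendsto.div_atTop (tendsto_const_nhds (x := Real.log c)) Real.tendsto_log_atTop).add_const x
    simpa using this
  rw [tendsto_order]
  have lower : ∀ x ∈ G, ∃ c : ℝ, 0 < c ∧ ∀ᶠ ρ in Filter.atTop, 0 < (Pr ρ).toReal ∧ 
      Real.log c / Real.log ρ + (-x) ≤ Real.log (Pr ρ).toReal / Real.log ρ := by
    intro x hx
    obtain ⟨c, hc, hlo⟩ := lo x hx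
    obtain ⟨C, hC, hup⟩ := up 1 one_pos
    refine ⟨c, hc, ?_⟩
    filter_upwards [hlo, Filter.eventually_gt_atTop 1] with ρ h1 h2
    have hρ : 0 < ρ := by linarith
    have hfin : Pr ρ ≠ ⊤ := ne_top_of_le_ne_top ENNReal.ofReal_ne_top (hup ρ h2)
    have hle : c * ρ ^ (-x) ≤ (Pr ρ).toReal := by
      have := ENNReal.toReal_mono hfin h1
      rwa [ENNReal.toReal_ofReal (by positivity)] at this
    have hpos : 0 < c * ρ ^ (-x) := by positivity
    refine ⟨hpos.trans_le hle, ?_⟩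
    have hl : 0 < Real.log ρ := Real.log_pos h2
    rw [le_div_iff₀ hl, add_mul, div_mul_cancel₀ _ hl.ne']
    have := Real.log_le_log hpos hle
    rwa [Real.log_mul hc.ne' (by positivity), Real.log_rpow hρ] at this
  constructor
  · intro a ha
    obtain ⟨x, hx, hxa⟩ := exists_lt_of_csInf_lt hne (show sInf G < -a by linarith)
    obtain ⟨c, hc, hev⟩ := lower x hx
    filter_upwards [hev, (tendsto_order.1 (hlog c (-x))).1 a (by linarith)] with ρ h1 h2
    linarith [h1.2]
  · intro a ha
    obtain ⟨x, hx⟩ := hne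
    obtain ⟨c, hc, hev⟩ := lower x hx
    obtain ⟨C, hC, hup⟩ := up ((a + sInf G) / 2) (by linarith)
    filter_upwards [hev, (tendsto_order.1 (hlog C (-(sInf G) + (a + sInf G) / 2))).2 a (by linarith),
      Filter.eventually_gt_atTop 1] with ρ h1 h2 h3
    refine lt_of_le_of_lt ?_ h2
    have hρ : 0 < ρ := by linarith
    have hl : 0 < Real.log ρ := Real.log_pos h3
    rw [div_le_iff₀ hl, add_mul, div_mul_cancel₀ _ hl.ne']
    have hle : (Pr ρ).toReal ≤ C * ρ ^ (-(sInf G) + (a + sInf G) / 2) :=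
      ENNReal.toReal_le_of_le_ofReal (by positivity) (hup ρ h3)
    have := Real.log_le_log h1.1 hle
    rwa [Real.log_mul hC.ne' (by positivity), Real.log_rpow hρ] at this

lemma block_lower (p q M : ℕ) (hM : 0 < M) (α : ℕ → ℝ) (hα : ∀ j, 0 ≤ α j) (ε : ℝ) (hε : 0 < ε) :
    ∃ c : ℝ, 0 < c ∧ ∀ᶠ ρ : ℝ in Filter.atTop,
      ENNReal.ofReal (c * ρ ^ (-(∑ j ∈ Finset.range (min p q), ww p q j * α j))) ≤
        mG p q {H | Real.log (ff (ρ / M) (Matrix.of H)) ≤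
          ((∑ j ∈ Finset.range (min p q), max (1 - α j) 0) + ε) * Real.log ρ} := by
  obtain ⟨B, K, c, hB, hK, hc, hI⟩ := lower_bound α hα p q
  obtain ⟨c', hc', hG⟩ := mG_lower (p := p) (q := q) B
  have hM' : (1 : ℝ) ≤ M := by exact_mod_cast hM
  refine ⟨c' * c, by positivity, ?_⟩
  have hK' := (Filter.Tendsto.const_mul_atTop hε Real.tendsto_log_atTop).eventually_ge_atTop (Real.log K)
  filter_upwards [hK', Filter.eventually_ge_atTop (M : ℝ)] with ρ h1 h2
  have hρ1 : 1 ≤ ρ := hM'.trans h2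
  have hρ0 : 0 < ρ := by linarith
  have hρ' : 1 ≤ ρ / M := by rw [one_le_div (by linarith)]; exact h2
  have hle : ρ / M ≤ ρ := div_le_self hρ0.le hM'
  have hI' := hI (ρ / M) hρ'
  have hS0 : 0 ≤ ∑ j ∈ Finset.range (min p q), max (1 - α j) 0 := Finset.sum_nonneg fun j _ => le_max_right _ _
  have hD0 : 0 ≤ ∑ j ∈ Finset.range (min p q), ww p q j * α j :=
    Finset.sum_nonneg fun j _ => mul_nonneg (ww_pos _ _ _).le (hα j)
  change ENNReal.ofReal (c * (ρ / M) ^ (-(∑ j ∈ Finset.range (min p q), ww p q j * α j))) ≤ _ at hI'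
  set S := ∑ j ∈ Finset.range (min p q), max (1 - α j) 0
  set D := ∑ j ∈ Finset.range (min p q), ww p q j * α j
  calc ENNReal.ofReal (c' * c * ρ ^ (-D)) ≤ ENNReal.ofReal c' * ENNReal.ofReal (c * (ρ / M) ^ (-D)) := by
        rw [← ENNReal.ofReal_mul hc'.le, mul_assoc]
        apply ENNReal.ofReal_le_ofReal
        have := Real.rpow_le_rpow_of_nonpos (by linarith : 0 < ρ / M) hle (by linarith : -D ≤ 0)
        gcongr
    _ ≤ ENNReal.ofReal c' * _ := mul_le_mul' le_rfl hI'
    _ ≤ _ := hG _ (measurableSet_lowset _ _ _) (fun H hH => hH.1)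
    _ ≤ _ := by
        apply measure_mono
        intro H hH
        have hf1 := one_le_ff (show 0 ≤ ρ / M by linarith) (Matrix.of H)
        have := Real.log_le_log (by linarith) hH.2
        rw [Real.log_mul hK.ne' (by positivity), Real.log_rpow (by linarith)] at this
        have h3 : S * Real.log (ρ / M) ≤ S * Real.log ρ :=
          mul_le_mul_of_nonneg_left (Real.log_le_log (by linarith) hle) hS0
        show _ ≤ (S + ε) * Real.log ρ
        linarith

lemma Sext_sum {p q L : ℕ} (α : Fin (min q p) → Fin L → ℝ) (a : ℕ → ℕ → ℝ)
    (h : ∀ (j : Fin (min q p)) (l : Fin L), a l j = α j l) (l : ℕ) (hl : l < L) :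
    Sext α l = ∑ j ∈ Finset.range (min p q), max (1 - a l j) 0 := by
  rw [Sext, dif_pos hl, min_comm p q, Finset.sum_range]
  exact Finset.sum_congr rfl fun j _ => by rw [← h j ⟨l, hl⟩]

lemma h_sum {p q L : ℕ} (α : Fin (min q p) → Fin L → ℝ) (a : ℕ → ℕ → ℝ)
    (h : ∀ (j : Fin (min q p)) (l : Fin L), a l j = α j l) :
    ∑ j, ∑ l, (2 * (j.val : ℝ) + 1 + |(q : ℝ) - (p : ℝ)|) * α j l =
      ∑ l ∈ Finset.range L, ∑ j ∈ Finset.range (min p q), ww p q j * a l j := by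
  rw [Finset.sum_comm, Finset.sum_range]
  refine Finset.sum_congr rfl fun l _ => ?_
  rw [min_comm p q, Finset.sum_range]
  refine Finset.sum_congr rfl fun j _ => ?_
  rw [h, ww, abs_sub_comm]

lemma Sext_nonneg {m L : ℕ} (α : Fin m → Fin L → ℝ) (l : ℕ) : 0 ≤ Sext α l := by
  unfold Sext
  split_ifs
  · exact Finset.sum_nonneg fun _ _ => le_max_right _ _
  · exact le_rfl

lemma prod_ofReal_rpow (s : Finset ℕ) (c x : ℕ → ℝ) (hc : ∀ l, 0 < c l) (ρ : ℝ) (hρ : 0 < ρ) :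
    ∏ l ∈ s, ENNReal.ofReal (c l * ρ ^ (-(x l))) = ENNReal.ofReal ((∏ l ∈ s, c l) * ρ ^ (-(∑ l ∈ s, x l))) := by
  rw [← ENNReal.ofReal_prod_of_nonneg (fun l _ => by have := hc l; positivity), Finset.prod_mul_distrib,
    ← Finset.sum_neg_distrib, Real.rpow_sum_of_pos hρ]

lemma event_lower {Ω : Type*} [MeasurableSpace Ω] (P : Measure Ω) 
    (M1 M2 M3 : ℕ) (hM1 : 0 < M1) (hM2 : 0 < M2)
    (L : ℕ) (r : ℝ)
    (H1 : ℕ → Ω → Matrix (Fin M2) (Fin M1) ℂ) (H2 : ℕ → Ω → Matrix (Fin M3) (Fin M2) ℂ)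
    (hlaw : ∀ (A1 : ℕ → Set (Fin M2 → Fin M1 → ℂ)) (A2 : ℕ → Set (Fin M3 → Fin M2 → ℂ)),
      (∀ l, MeasurableSet (A1 l)) → (∀ l, MeasurableSet (A2 l)) →
      P {ω | ∀ l < L, (fun i j => H1 l ω i j) ∈ A1 l ∧ (fun i j => H2 l ω i j) ∈ A2 l} =
      (∏ l ∈ Finset.range L, mG M2 M1 (A1 l)) * (∏ l ∈ Finset.range L, mG M3 M2 (A2 l)))
    (a1 a2 : ℕ → ℕ → ℝ) (h1 : ∀ l j, 0 ≤ a1 l j) (h2 : ∀ l j, 0 ≤ a2 l j)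
    (hbad : Bad L (fun l => ∑ j ∈ Finset.range (min M2 M1), max (1 - a1 l j) 0)
      (fun l => ∑ j ∈ Finset.range (min M3 M2), max (1 - a2 l j) 0) r) :
    ∃ c : ℝ, 0 < c ∧ ∀ᶠ ρ : ℝ in Filter.atTop,
      ENNReal.ofReal (c * ρ ^ (-((∑ l ∈ Finset.range L, ∑ j ∈ Finset.range (min M2 M1), ww M2 M1 j * a1 l j)
        + ∑ l ∈ Finset.range L, ∑ j ∈ Finset.range (min M3 M2), ww M3 M2 j * a2 l j))) ≤
      P {ω | Bad L (fun l => cap M1 ρ (H1 l ω)) (fun l => cap M2 ρ (H2 l ω)) (r * Real.log ρ)} := by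
  obtain ⟨ε, hε, hb⟩ := hbad.slack
  choose c1 hc1 hl1 using fun l => block_lower M2 M1 M1 hM1 (a1 l) (h1 l) ε hε
  choose c2 hc2 hl2 using fun l => block_lower M3 M2 M2 hM2 (a2 l) (h2 l) ε hε
  refine ⟨(∏ l ∈ Finset.range L, c1 l) * ∏ l ∈ Finset.range L, c2 l,
    mul_pos (Finset.prod_pos fun l _ => hc1 l) (Finset.prod_pos fun l _ => hc2 l), ?_⟩
  have e1 := (Filter.eventually_all_finset (Finset.range L)).mpr (fun l _ => hl1 l)
  have e2 := (Filter.eventually_all_finset (Finset.range L)).mpr (fun l _ => hl2 l)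
  filter_upwards [e1, e2, Filter.eventually_gt_atTop 1] with ρ g1 g2 g3
  have hρ : 0 < ρ := by linarith
  have hlog : 0 < Real.log ρ := Real.log_pos g3
  have hm : ∀ (p q M : ℕ) (X : ℝ), MeasurableSet {H : Fin p → Fin q → ℂ | Real.log (ff (ρ / M) (Matrix.of H)) ≤ X} := by
    intro p q M X
    exact measurableSet_le (Real.measurable_log.comp (continuous_ff _).measurable) measurable_const
  have hl := hlaw (fun l => {H | Real.log (ff (ρ / M1) (Matrix.of H)) ≤
      ((∑ j ∈ Finset.range (min M2 M1), max (1 - a1 l j) 0) + ε) * Real.log ρ})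
    (fun l => {H | Real.log (ff (ρ / M2) (Matrix.of H)) ≤
      ((∑ j ∈ Finset.range (min M3 M2), max (1 - a2 l j) 0) + ε) * Real.log ρ}) (fun l => hm _ _ _ _) (fun l => hm _ _ _ _)
  calc _ = (∏ l ∈ Finset.range L, ENNReal.ofReal (c1 l * ρ ^ (-(∑ j ∈ Finset.range (min M2 M1), ww M2 M1 j * a1 l j)))) *
        ∏ l ∈ Finset.range L, ENNReal.ofReal (c2 l * ρ ^ (-(∑ j ∈ Finset.range (min M3 M2), ww M3 M2 j * a2 l j))) := by
        rw [prod_ofReal_rpow _ _ _ hc1 _ hρ, prod_ofReal_rpow _ _ _ hc2 _ hρ, ← ENNReal.ofReal_mul]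
        · congr 1
          rw [neg_add, Real.rpow_add hρ]; ring
        · exact mul_nonneg (Finset.prod_nonneg fun l _ => (hc1 l).le) (by positivity)
    _ ≤ _ := mul_le_mul' (Finset.prod_le_prod' g1) (Finset.prod_le_prod' g2)
    _ = _ := hl.symm
    _ ≤ _ := by
        apply measure_mono
        intro ω hω
        have hb' := hb.smul hlog
        rw [mul_comm] at hb'
        refine hb'.mono (fun l hl => ?_) (fun l hl => ?_)
        · have := (hω l hl).1
          rw [mul_comm]; exact this
        · have := (hω l hl).2
          rw [mul_comm]; exact this

open MeasureTheory ProbabilityTheory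

lemma quant (p q M K N : ℕ) (hN : 0 < N) (ρ : ℝ) (hρ : 1 < ρ) (H : Fin p → Fin q → ℂ) :
    ∃ k : ℕ, k ≤ K ∧ (k : ℝ) * (1 / N) ≤ (1 / Real.log ρ) * cap M ρ (Matrix.of H) ∧
      H ∈ cell p q M K (1 / N) ρ k := by
  have hl : 0 < Real.log ρ := Real.log_pos hρ
  have hN' : (0 : ℝ) < N := by exact_mod_cast hN
  have hc := cap_nonneg M ρ (by linarith) (Matrix.of H)
  set y := (1 / Real.log ρ) * cap M ρ (Matrix.of H) with hy
  have hy0 : 0 ≤ y := by positivity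
  have hcy : cap M ρ (Matrix.of H) = y * Real.log ρ := by rw [hy]; field_simp
  refine ⟨min ⌊(N : ℝ) * y⌋₊ K, min_le_right _ _, ?_, ?_⟩
  · have h1 : ((min ⌊(N : ℝ) * y⌋₊ K : ℕ) : ℝ) ≤ N * y := by
      calc ((min ⌊(N : ℝ) * y⌋₊ K : ℕ) : ℝ) ≤ (⌊(N : ℝ) * y⌋₊ : ℝ) := by exact_mod_cast min_le_left _ _
        _ ≤ _ := Nat.floor_le (by positivity)
    rw [mul_one_div, div_le_iff₀ hN']; linarith
  · rcases le_total K ⌊(N : ℝ) * y⌋₊ with h | h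
    · left; exact min_eq_right h
    · right
      rw [min_eq_left h]
      have h2 := Nat.lt_floor_add_one ((N : ℝ) * y)
      have h3 : y ≤ ((⌊(N : ℝ) * y⌋₊ : ℝ) + 1) * (1 / N) := by
        rw [mul_one_div, le_div_iff₀ hN']; linarith
      have hf := one_le_ff (show 0 ≤ ρ / M by positivity) (Matrix.of H)
      rw [← Real.log_le_log_iff (by linarith) (by positivity), Real.log_rpow (by linarith), ← cap_eq, hcy]
      gcongr

lemma prod_cell (p q M N L : ℕ) (ε C : ℝ) (hC : 1 ≤ C)
    (hb : ∀ k : ℕ, k ≤ N * min p q → ∀ ρ : ℝ, 1 < ρ →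
      mG p q (cell p q M (N * min p q) (1 / N) ρ k) ≤
        ENNReal.ofReal (C * ρ ^ (-(dd p q (k * (1 / N))) + p * q * (1 / N) + ε)))
    (k : ℕ → ℕ) (hk : ∀ l, k l ≤ N * min p q) (ρ : ℝ) (hρ : 1 < ρ) :
    ∏ l ∈ Finset.range L, mG p q (cell p q M (N * min p q) (1 / N) ρ (k l)) ≤
      ENNReal.ofReal (C ^ L * ρ ^ (-(∑ l ∈ Finset.range L, dd p q (k l * (1 / N))) + L * (p * q * (1 / N) + ε))) := by
  refine (Finset.prod_le_prod' (fun l _ => hb (k l) (hk l) ρ hρ)).trans ?_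
  have := prod_ofReal_rpow (Finset.range L) (fun _ => C) (fun l => dd p q (k l * (1 / N)) - (p * q * (1 / N) + ε))
    (fun _ => by linarith) ρ (by linarith)
  have e : ∀ l, -(dd p q (k l * (1 / N))) + p * q * (1 / N) + ε = -(dd p q (k l * (1 / N)) - (p * q * (1 / N) + ε)) := by
    intro l; ring
  simp only [e]
  rw [this, Finset.sum_sub_distrib, Finset.prod_const, Finset.card_range, Finset.sum_const, Finset.card_range, nsmul_eq_mul]
  apply le_of_eq
  congr 3
  ring

lemma event_upper {Ω : Type*} [MeasurableSpace Ω] (P : Measure Ω) 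
    (M1 M2 M3 : ℕ) (hM1 : 0 < M1) (hM2 : 0 < M2)
    (L : ℕ) (r : ℝ)
    (H1 : ℕ → Ω → Matrix (Fin M2) (Fin M1) ℂ) (H2 : ℕ → Ω → Matrix (Fin M3) (Fin M2) ℂ)
    (hlaw : ∀ (A1 : ℕ → Set (Fin M2 → Fin M1 → ℂ)) (A2 : ℕ → Set (Fin M3 → Fin M2 → ℂ)),
      (∀ l, MeasurableSet (A1 l)) → (∀ l, MeasurableSet (A2 l)) →
      P {ω | ∀ l < L, (fun i j => H1 l ω i j) ∈ A1 l ∧ (fun i j => H2 l ω i j) ∈ A2 l} =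
      (∏ l ∈ Finset.range L, mG M2 M1 (A1 l)) * (∏ l ∈ Finset.range L, mG M3 M2 (A2 l)))
    (I : ℝ)
    (hI : ∀ N : ℕ, 0 < N → ∀ k1 k2 : ℕ → ℕ, (∀ l, k1 l ≤ N * min M2 M1) → (∀ l, k2 l ≤ N * min M3 M2) →
      Bad L (fun l => (k1 l : ℝ) * (1 / N)) (fun l => (k2 l : ℝ) * (1 / N)) r →
      I ≤ (∑ l ∈ Finset.range L, dd M2 M1 (k1 l * (1 / N))) + ∑ l ∈ Finset.range L, dd M3 M2 (k2 l * (1 / N)))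
    (ε : ℝ) (hε : 0 < ε) :
    ∃ C : ℝ, 0 < C ∧ ∀ ρ : ℝ, 1 < ρ →
      P {ω | Bad L (fun l => cap M1 ρ (H1 l ω)) (fun l => cap M2 ρ (H2 l ω)) (r * Real.log ρ)} ≤
        ENNReal.ofReal (C * ρ ^ (-I + ε)) := by
  classical
  obtain ⟨N, hN⟩ := exists_nat_gt ((L * (M2 * M1 + M3 * M2) : ℝ) / (ε / 2))
  have hN' : (0 : ℝ) < N := lt_of_le_of_lt (by positivity) hN
  have hN0 : 0 < N := by exact_mod_cast hN'
  have hNb : (L * (M2 * M1 + M3 * M2) : ℝ) * (1 / N) ≤ ε / 2 := by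
    rw [div_lt_iff₀ (by positivity)] at hN
    rw [mul_one_div, div_le_iff₀ hN']; linarith
  set η := ε / (4 * (L + 1)) with hη
  have hη0 : 0 < η := by positivity
  have hηb : (L : ℝ) * (2 * η) ≤ ε / 2 := by
    have : (L + 1 : ℝ) * (2 * η) = ε / 2 := by rw [hη]; field_simp; ring
    nlinarith
  obtain ⟨C1, hC1, hb1⟩ := cell_bound M2 M1 M1 N hM1 hN0 η hη0
  obtain ⟨C2, hC2, hb2⟩ := cell_bound M3 M2 M2 N hM2 hN0 η hη0
  set K1 := N * min M2 M1 with hK1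
  set K2 := N * min M3 M2 with hK2
  let ex : ∀ K : ℕ, (Fin L → Fin (K + 1)) → ℕ → ℕ := fun K κ l => if h : l < L then (κ ⟨l, h⟩ : ℕ) else 0
  have hex : ∀ K κ l, ex K κ l ≤ K := by
    intro K κ l
    simp only [ex]
    split_ifs with h
    · exact Nat.lt_succ_iff.mp (κ ⟨l, h⟩).2
    · exact Nat.zero_le _
  let J : Finset ((Fin L → Fin (K1 + 1)) × (Fin L → Fin (K2 + 1))) :=
    Finset.univ.filter fun κ => Bad L (fun l => (ex K1 κ.1 l : ℝ) * (1 / N)) (fun l => (ex K2 κ.2 l : ℝ) * (1 / N)) r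
  refine ⟨(J.card + 1) * (C1 ^ L * C2 ^ L), by positivity, fun ρ hρ => ?_⟩
  have hl : 0 < Real.log ρ := Real.log_pos hρ
  have hρ0 : 0 < ρ := by linarith
  let E : (Fin L → Fin (K1 + 1)) × (Fin L → Fin (K2 + 1)) → Set Ω := fun κ =>
    {ω | ∀ l < L, (fun i j => H1 l ω i j) ∈ cell M2 M1 M1 K1 (1 / N) ρ (ex K1 κ.1 l) ∧
      (fun i j => H2 l ω i j) ∈ cell M3 M2 M2 K2 (1 / N) ρ (ex K2 κ.2 l)}
  have hsub : {ω | Bad L (fun l => cap M1 ρ (H1 l ω)) (fun l => cap M2 ρ (H2 l ω)) (r * Real.log ρ)} ⊆ ⋃ κ ∈ J, E κ := by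
    intro ω hω
    choose k1 hk1 hk1' hk1'' using fun l => quant M2 M1 M1 K1 N hN0 ρ hρ (fun i j => H1 l ω i j)
    choose k2 hk2 hk2' hk2'' using fun l => quant M3 M2 M2 K2 N hN0 ρ hρ (fun i j => H2 l ω i j)
    have e1 : ∀ l < L, ex K1 (fun l => ⟨k1 l, Nat.lt_succ_iff.mpr (hk1 l)⟩) l = k1 l := by
      intro l hl; simp [ex, hl]
    have e2 : ∀ l < L, ex K2 (fun l => ⟨k2 l, Nat.lt_succ_iff.mpr (hk2 l)⟩) l = k2 l := by
      intro l hl; simp [ex, hl]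
    rw [Set.mem_iUnion₂]
    refine ⟨(fun l => ⟨k1 l, Nat.lt_succ_iff.mpr (hk1 l)⟩, fun l => ⟨k2 l, Nat.lt_succ_iff.mpr (hk2 l)⟩), ?_, ?_⟩
    · simp only [J, Finset.mem_filter, Finset.mem_univ, true_and]
      have hb := Bad.smul hω (show 0 < 1 / Real.log ρ by positivity)
      have hr : 1 / Real.log ρ * (r * Real.log ρ) = r := by field_simp
      rw [hr] at hb
      refine hb.mono (fun l hl => ?_) (fun l hl => ?_)
      · rw [e1 l hl]; exact hk1' l
      · rw [e2 l hl]; exact hk2' l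
    · intro l hl
      simp only [e1 l hl, e2 l hl]
      exact ⟨hk1'' l, hk2'' l⟩
  have hE : ∀ κ ∈ J, P (E κ) ≤ ENNReal.ofReal (C1 ^ L * C2 ^ L * ρ ^ (-I + ε)) := by
    intro κ hκ
    have hbad := (Finset.mem_filter.mp hκ).2
    have hI' := hI N hN0 _ _ (hex K1 κ.1) (hex K2 κ.2) hbad
    have h0 := hlaw (fun l => cell M2 M1 M1 K1 (1 / N) ρ (ex K1 κ.1 l)) (fun l => cell M3 M2 M2 K2 (1 / N) ρ (ex K2 κ.2 l))
      (fun l => measurableSet_cell _ _ _ _ _ _ _) (fun l => measurableSet_cell _ _ _ _ _ _ _)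
    calc P (E κ) = _ := h0
      _ ≤ _ := mul_le_mul' (prod_cell M2 M1 M1 N L η C1 hC1 hb1 _ (hex K1 κ.1) ρ hρ)
          (prod_cell M3 M2 M2 N L η C2 hC2 hb2 _ (hex K2 κ.2) ρ hρ)
      _ ≤ _ := by
        rw [← ENNReal.ofReal_mul (by positivity)]
        apply ENNReal.ofReal_le_ofReal
        rw [mul_mul_mul_comm, ← Real.rpow_add hρ0]
        refine mul_le_mul_of_nonneg_left (Real.rpow_le_rpow_of_exponent_le hρ.le ?_) (by positivity)
        have : (L : ℝ) * (M2 * M1 * (1 / N) + η) + L * (M3 * M2 * (1 / N) + η) =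
          (L * (M2 * M1 + M3 * M2) : ℝ) * (1 / N) + L * (2 * η) := by ring
        linarith
  calc _ ≤ P (⋃ κ ∈ J, E κ) := measure_mono hsub
    _ ≤ ∑ κ ∈ J, P (E κ) := measure_biUnion_finset_le _ _
    _ ≤ ∑ κ ∈ J, ENNReal.ofReal (C1 ^ L * C2 ^ L * ρ ^ (-I + ε)) := Finset.sum_le_sum hE
    _ = ENNReal.ofReal (J.card * (C1 ^ L * C2 ^ L * ρ ^ (-I + ε))) := by
      rw [Finset.sum_const, nsmul_eq_mul, ENNReal.ofReal_mul (p := (J.card : ℝ)) (by positivity), ENNReal.ofReal_natCast]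
    _ ≤ _ := by
      apply ENNReal.ofReal_le_ofReal
      have : 0 ≤ C1 ^ L * C2 ^ L * ρ ^ (-I + ε) := by positivity
      nlinarith

/-- **Theorem 6** (DMDT of the VBL ARQ protocol, three-node network, short-term static
channel): the probability `P(t₁(ρ) + t₂(ρ) > L)` has SNR exponent `- inf {h̃(α) : α ∈ G}`,
where `h̃(α) = Σ_{i,j,l} (2j - 1 + |M_i - M_{i+1}|) α_{i,j}^l` and `G` is the set of
nonnegative decreasingly-ordered (in `j`) `α = (α₁, α₂)`, `α_i ∈ ℝ^{M_i^* × L}`, with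
`T₁(α) + T₂(α) > L`, where `T_i(α)` is the fractional time at which the accumulated
`S_i` reaches `r`. -/
theorem VBL_DMDT_threeNode_shortTerm
    {Ω : Type*} [MeasurableSpace Ω] (P : Measure Ω) [IsProbabilityMeasure P]
    (M1 M2 M3 : ℕ) (hM1 : 0 < M1) (hM2 : 0 < M2) (hM3 : 0 < M3)
    (L : ℕ) (hL : 0 < L) (r : ℝ) (hr : 0 < r)
    (H1 : ℕ → Ω → Matrix (Fin M2) (Fin M1) ℂ) (H2 : ℕ → Ω → Matrix (Fin M3) (Fin M2) ℂ)
    (hGauss : Measure.map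
      (fun ω (p : ((Fin (L+1) × Fin M2 × Fin M1) ⊕ (Fin (L+1) × Fin M3 × Fin M2)) × Bool) =>
        Sum.elim
          (fun q => if p.2 then (H1 q.1 ω q.2.1 q.2.2).re else (H1 q.1 ω q.2.1 q.2.2).im)
          (fun q => if p.2 then (H2 q.1 ω q.2.1 q.2.2).re else (H2 q.1 ω q.2.1 q.2.2).im)
          p.1) P
      = Measure.pi (fun _ => gaussianReal 0 (1/2))) :
    Filter.Tendsto (fun ρ : ℝ =>
        Real.log ((P {ω | fracDecTime (fun l => cap M1 ρ (H1 l ω)) (r * Real.log ρ)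
                          + fracDecTime (fun l => cap M2 ρ (H2 l ω)) (r * Real.log ρ)
                          > ((L : ℝ) : EReal)}).toReal)
          / Real.log ρ)
      Filter.atTop
      (nhds (-(sInf {x : ℝ |
          ∃ (α1 : Fin (min M1 M2) → Fin L → ℝ) (α2 : Fin (min M2 M3) → Fin L → ℝ),
            (∀ l j k, j ≤ k → α1 k l ≤ α1 j l) ∧ (∀ j l, 0 ≤ α1 j l) ∧
            (∀ l j k, j ≤ k → α2 k l ≤ α2 j l) ∧ (∀ j l, 0 ≤ α2 j l) ∧
            fracDecTime (Sext α1) r + fracDecTime (Sext α2) r > ((L : ℝ) : EReal) ∧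
            x = (∑ j, ∑ l, (2 * (j.val : ℝ) + 1 + |(M1 : ℝ) - (M2 : ℝ)|) * α1 j l)
              + (∑ j, ∑ l, (2 * (j.val : ℝ) + 1 + |(M2 : ℝ) - (M3 : ℝ)|) * α2 j l)}))) := by
  have hlaw := law_H P M1 M2 M3 L H1 H2 hGauss
  have hev : ∀ ρ : ℝ, 0 ≤ ρ → {ω | fracDecTime (fun l => cap M1 ρ (H1 l ω)) (r * Real.log ρ)
                          + fracDecTime (fun l => cap M2 ρ (H2 l ω)) (r * Real.log ρ)
                          > ((L : ℝ) : EReal)} =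
      {ω | Bad L (fun l => cap M1 ρ (H1 l ω)) (fun l => cap M2 ρ (H2 l ω)) (r * Real.log ρ)} := by
    intro ρ hρ
    ext ω
    exact dec_iff _ _ _ (fun l => cap_nonneg _ _ hρ _) (fun l => cap_nonneg _ _ hρ _) _
  apply final_limit (fun ρ => P {ω | fracDecTime (fun l => cap M1 ρ (H1 l ω)) (r * Real.log ρ)
                          + fracDecTime (fun l => cap M2 ρ (H2 l ω)) (r * Real.log ρ)
                          > ((L : ℝ) : EReal)})
  · refine ⟨_, fun _ _ => 1, fun _ _ => 1, fun _ _ _ _ => le_rfl, fun _ _ => zero_le_one, fun _ _ _ _ => le_rfl,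
      fun _ _ => zero_le_one, ?_, rfl⟩
    rw [dec_iff _ _ _ (Sext_nonneg _) (Sext_nonneg _)]
    intro s _ _
    left
    have : kern (Sext (fun (_ : Fin (min M1 M2)) (_ : Fin L) => (1 : ℝ))) L s = 0 := by
      unfold kern
      refine Finset.sum_eq_zero fun l _ => ?_
      simp [Sext]
    rw [this]; exact hr
  · rintro x ⟨α1, α2, -, p1, -, p2, hdec, rfl⟩
    rw [dec_iff _ _ _ (Sext_nonneg _) (Sext_nonneg _)] at hdec
    let a1 : ℕ → ℕ → ℝ := fun l j => if h : j < min M1 M2 ∧ l < L then α1 ⟨j, h.1⟩ ⟨l, h.2⟩ else 0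
    let a2 : ℕ → ℕ → ℝ := fun l j => if h : j < min M2 M3 ∧ l < L then α2 ⟨j, h.1⟩ ⟨l, h.2⟩ else 0
    have e1 : ∀ (j : Fin (min M1 M2)) (l : Fin L), a1 l j = α1 j l := fun j l => dif_pos ⟨j.2, l.2⟩
    have e2 : ∀ (j : Fin (min M2 M3)) (l : Fin L), a2 l j = α2 j l := fun j l => dif_pos ⟨j.2, l.2⟩
    have n1 : ∀ l j, 0 ≤ a1 l j := by
      intro l j
      simp only [a1]
      split_ifs with h
      · exact p1 _ _
      · exact le_rfl
    have n2 : ∀ l j, 0 ≤ a2 l j := by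
      intro l j
      simp only [a2]
      split_ifs with h
      · exact p2 _ _
      · exact le_rfl
    rw [h_sum α1 a1 e1, h_sum α2 a2 e2]
    obtain ⟨c, hc, hh⟩ := event_lower P M1 M2 M3 hM1 hM2 L r H1 H2 hlaw a1 a2 n1 n2
      (hdec.mono (fun l hl => (Sext_sum α1 a1 e1 l hl).ge) (fun l hl => (Sext_sum α2 a2 e2 l hl).ge))
    refine ⟨c, hc, ?_⟩
    filter_upwards [hh, Filter.eventually_ge_atTop 0] with ρ h1 h2
    rw [hev ρ h2]; exact h1
  · intro ε hε
    obtain ⟨C, hC, hh⟩ := event_upper P M1 M2 M3 hM1 hM2 L r H1 H2 hlaw _ (by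
      intro N hN k1 k2 hk1 hk2 hbad
      have hN' : (0 : ℝ) < N := by exact_mod_cast hN
      have hkm : ∀ k m : ℕ, k ≤ N * m → (k : ℝ) * (1 / N) ≤ m := by
        intro k m h
        rw [mul_one_div, div_le_iff₀ hN', mul_comm]
        exact_mod_cast h
      let a1 : ℕ → ℕ → ℝ := fun l j => al (min M2 M1) (k1 l * (1 / N)) j
      let a2 : ℕ → ℕ → ℝ := fun l j => al (min M3 M2) (k2 l * (1 / N)) j
      refine csInf_le (s := {x : ℝ |
          ∃ (α1 : Fin (min M1 M2) → Fin L → ℝ) (α2 : Fin (min M2 M3) → Fin L → ℝ),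
            (∀ l j k, j ≤ k → α1 k l ≤ α1 j l) ∧ (∀ j l, 0 ≤ α1 j l) ∧
            (∀ l j k, j ≤ k → α2 k l ≤ α2 j l) ∧ (∀ j l, 0 ≤ α2 j l) ∧
            fracDecTime (Sext α1) r + fracDecTime (Sext α2) r > ((L : ℝ) : EReal) ∧
            x = (∑ j, ∑ l, (2 * (j.val : ℝ) + 1 + |(M1 : ℝ) - (M2 : ℝ)|) * α1 j l)
              + (∑ j, ∑ l, (2 * (j.val : ℝ) + 1 + |(M2 : ℝ) - (M3 : ℝ)|) * α2 j l)}) ⟨0, ?_⟩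
        ⟨fun j l => a1 l j, fun j l => a2 l j, fun l j k h => al_anti _ _ h, fun j l => al_nonneg _ _ _,
          fun l j k h => al_anti _ _ h, fun j l => al_nonneg _ _ _, ?_, ?_⟩
      · rintro x ⟨α1, α2, -, p1, -, p2, -, rfl⟩
        refine add_nonneg ?_ ?_
        · exact Finset.sum_nonneg fun j _ => Finset.sum_nonneg fun l _ => mul_nonneg (by positivity) (p1 _ _)
        · exact Finset.sum_nonneg fun j _ => Finset.sum_nonneg fun l _ => mul_nonneg (by positivity) (p2 _ _)
      · rw [dec_iff _ _ _ (Sext_nonneg _) (Sext_nonneg _)]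
        refine hbad.mono (fun l hl => ?_) (fun l hl => ?_)
        · rw [Sext_sum (p := M2) (q := M1) _ a1 (fun _ _ => rfl) l hl]
          exact (sum_one_sub_al _ _ (by positivity) (hkm _ _ (hk1 l))).le
        · rw [Sext_sum (p := M3) (q := M2) _ a2 (fun _ _ => rfl) l hl]
          exact (sum_one_sub_al _ _ (by positivity) (hkm _ _ (hk2 l))).le
      · rw [h_sum (p := M2) (q := M1) _ a1 (fun _ _ => rfl), h_sum (p := M3) (q := M2) _ a2 (fun _ _ => rfl)]
        rfl) ε hε
    refine ⟨C, hC, fun ρ hρ => ?_⟩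
    rw [hev ρ (by linarith)]; exact hh ρ hρ
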